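/- Let 1 < p < ∞, let W be a matrix A_p weight on ℝ^d with reducing operators V_I, fix I_0 ∈ 𝒟, and let 𝒥 be the stopping time where 𝒥(I) consists of the maximal dyadic subcubes J of I with ‖V_J V_I^{−1}‖^p > λ₁ or ‖V_J^{−1} V_I‖^{p'} > λ₂, with λ₁, λ₂ chosen as in the decay lemma (λ₁ depending only on n, d, p and λ₂ ≈ ‖W‖_{A_p}^{p'/p}). Define T f⃗ := ∑_{I ∈ 𝒟(I_0)} ∑_{ε ∈ 𝒮} W^{1/p} V_I^{−1} f⃗_I^ε h_I^ε and T_j f⃗ := T Δ_j f⃗. Then for every f⃗ with finite Haar expansion and every j ≥ 1, ∫_{ℝ^d} |T_j f⃗|^p dx ≤ C ‖W‖_{A_p} ‖Δ_j f⃗‖_{L^p}^p, where C depends only on p, n, d (and not on I_0). -/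

import Mathlib

open MeasureTheory ENNReal
open scoped ComplexOrder

noncomputable section

/-! ## Basic linear-algebra notation -/

/-- The operator norm of an `n × n` complex matrix, viewed as an operator on the
Euclidean space `ℂⁿ`. -/
def matNorm {n : ℕ} (M : Matrix (Fin n) (Fin n) ℂ) : ℝ :=
  ‖Matrix.toEuclideanCLM (𝕜 := ℂ) (n := Fin n) M‖

/-- A matrix applied to a vector of `ℂⁿ` (with its Euclidean norm). -/
def mApp {n : ℕ} (M : Matrix (Fin n) (Fin n) ℂ) (v : EuclideanSpace ℂ (Fin n)) :
    EuclideanSpace ℂ (Fin n) :=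
  Matrix.toEuclideanCLM (𝕜 := ℂ) (n := Fin n) M v


/-- Entrywise measurability of a matrix-valued function. -/
def MatMeasurable {d n : ℕ} (W : (Fin d → ℝ) → Matrix (Fin n) (Fin n) ℂ) : Prop :=
  ∀ i j, Measurable fun x => W x i j

/-! ## Dyadic cubes and Haar functions -/

/-- A dyadic cube in `ℝ^d`, with side length `2^k` and lower-left corner `(m i * 2^k)_i`. -/
structure DCube (d : ℕ) where
  k : ℤ
  m : Fin d → ℤ

namespace DCube

variable {d : ℕ}

/-- The (half-open) cube in `ℝ^d` determined by a dyadic cube. -/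
def set (I : DCube d) : Set (Fin d → ℝ) :=
  {x | ∀ i, (I.m i : ℝ) * 2 ^ I.k ≤ x i ∧ x i < ((I.m i : ℝ) + 1) * 2 ^ I.k}

/-- The volume `|I| = (2^k)^d` of a dyadic cube. -/
def vol (I : DCube d) : ℝ := ((2 : ℝ) ^ I.k) ^ d

/-- The lower-left corner of a dyadic cube. -/
def corner (I : DCube d) : Fin d → ℝ := fun i => (I.m i : ℝ) * 2 ^ I.k

/-- The side length of a dyadic cube. -/
def side (I : DCube d) : ℝ := (2 : ℝ) ^ I.k

end DCube

/-- One-dimensional Haar functions on the dyadic interval `[m·2^k, (m+1)·2^k)`: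
`haar1D true` is the non-cancellative `|I|^{-1/2} χ_I`, while `haar1D false` is
`|I|^{-1/2} (χ_{I_ℓ} - χ_{I_r})`. -/
def haar1D (ε : Bool) (k mm : ℤ) (t : ℝ) : ℝ :=
  if ε then
    Set.indicator {s : ℝ | (mm : ℝ) * 2 ^ k ≤ s ∧ s < ((mm : ℝ) + 1) * 2 ^ k}
      (fun _ => ((2 : ℝ) ^ k) ^ (-(1 / 2 : ℝ))) t
  else
    Set.indicator {s : ℝ | (mm : ℝ) * 2 ^ k ≤ s ∧ s < (mm : ℝ) * 2 ^ k + 2 ^ (k - 1)}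
      (fun _ => ((2 : ℝ) ^ k) ^ (-(1 / 2 : ℝ))) t -
    Set.indicator {s : ℝ | (mm : ℝ) * 2 ^ k + 2 ^ (k - 1) ≤ s ∧ s < ((mm : ℝ) + 1) * 2 ^ k}
      (fun _ => ((2 : ℝ) ^ k) ^ (-(1 / 2 : ℝ))) t

/-- The signature set `𝒮 = {0,1}^d \ {(1,…,1)}` indexing the cancellative Haar functions. -/
def Sfin (d : ℕ) : Finset (Fin d → Bool) := Finset.univ.erase (fun _ => true)

/-- The Haar function `h_I^ε = ∏ i, h_{I_i}^{ε_i}` associated to a dyadic cube `I ⊂ ℝ^d`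
and a signature `ε ∈ {0,1}^d`. -/
def haarFn {d : ℕ} (I : DCube d) (ε : Fin d → Bool) (x : Fin d → ℝ) : ℝ :=
  ∏ i, haar1D (ε i) I.k (I.m i) (x i)

/-- The (vector of) Haar coefficients `f_I^ε = ∫ f h_I^ε` of a `ℂⁿ`-valued function. -/
def haarCoef {d n : ℕ} (f : (Fin d → ℝ) → EuclideanSpace ℂ (Fin n)) (I : DCube d)
    (ε : Fin d → Bool) : EuclideanSpace ℂ (Fin n) :=
  ∫ x, haarFn I ε x • f x

/-! ## Matrix `A_p` weights and reducing operators -/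

/-- The (closed, axis-parallel) cube with corner `c` and side length `r`. -/
def cubeSet {d : ℕ} (c : Fin d → ℝ) (r : ℝ) : Set (Fin d → ℝ) :=
  {x | ∀ i, c i ≤ x i ∧ x i ≤ c i + r}

/-- The matrix `A_p` characteristic `‖W‖_{A_p}` of a matrix weight `W`, expressed in terms of
`W1p = W^{1/p}` (so that `W^{-1/p} = (W1p)⁻¹`):
`sup_I (1/|I|) ∫_I ((1/|I|) ∫_I ‖W^{1/p}(x) W^{-1/p}(t)‖^{p'} dt)^{p/p'} dx`,
the supremum being over all cubes `I ⊂ ℝ^d`.  Here `p' = p/(p-1)` and `p/p' = p - 1`. -/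
def apNorm {d n : ℕ} (p : ℝ) (W1p : (Fin d → ℝ) → Matrix (Fin n) (Fin n) ℂ) : ℝ≥0∞ :=
  ⨆ (c : Fin d → ℝ) (r : ℝ) (_ : 0 < r),
    (ENNReal.ofReal (r ^ d))⁻¹ *
      ∫⁻ x in cubeSet c r,
        ((ENNReal.ofReal (r ^ d))⁻¹ *
            ∫⁻ t in cubeSet c r,
              ENNReal.ofReal (matNorm (W1p x * (W1p t)⁻¹)) ^ (p / (p - 1))) ^ (p - 1)

/-- The `L^q` average `(|I|^{-1} ∫_I ‖A(x) e‖^q dx)^{1/q}` over a dyadic cube. -/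
def redAvgD {d n : ℕ} (q : ℝ) (A : (Fin d → ℝ) → Matrix (Fin n) (Fin n) ℂ) (I : DCube d)
    (e : EuclideanSpace ℂ (Fin n)) : ℝ≥0∞ :=
  ((ENNReal.ofReal I.vol)⁻¹ * ∫⁻ x in I.set, ENNReal.ofReal ‖mApp (A x) e‖ ^ q) ^ (1 / q)

/-- `V` is a family of reducing operators for the weight `W = (W1p)^p` (indexed by dyadic
cubes), with comparability constants `c₁, c₂`:  each `V I` is positive definite and
`|V_I e| ≈ (|I|^{-1} ∫_I |W^{1/p}(x) e|^p dx)^{1/p}`. -/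
def IsReducing {d n : ℕ} (p c₁ c₂ : ℝ) (W1p : (Fin d → ℝ) → Matrix (Fin n) (Fin n) ℂ)
    (V : DCube d → Matrix (Fin n) (Fin n) ℂ) : Prop :=
  ∀ I : DCube d, (V I).PosDef ∧ ∀ e : EuclideanSpace ℂ (Fin n),
    ENNReal.ofReal c₁ * redAvgD p W1p I e ≤ ENNReal.ofReal ‖mApp (V I) e‖ ∧
    ENNReal.ofReal ‖mApp (V I) e‖ ≤ ENNReal.ofReal c₂ * redAvgD p W1p I e

/-- `V'` is a family of dual reducing operators for the weight `W = (W1p)^p`: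
`|V_I' e| ≈ (|I|^{-1} ∫_I |W^{-1/p}(x) e|^{p'} dx)^{1/p'}` with `p' = p/(p-1)`. -/
def IsDualReducing {d n : ℕ} (p c₁ c₂ : ℝ) (W1p : (Fin d → ℝ) → Matrix (Fin n) (Fin n) ℂ)
    (V' : DCube d → Matrix (Fin n) (Fin n) ℂ) : Prop :=
  ∀ I : DCube d, (V' I).PosDef ∧ ∀ e : EuclideanSpace ℂ (Fin n),
    ENNReal.ofReal c₁ * redAvgD (p / (p - 1)) (fun x => (W1p x)⁻¹) I e ≤
        ENNReal.ofReal ‖mApp (V' I) e‖ ∧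
    ENNReal.ofReal ‖mApp (V' I) e‖ ≤
        ENNReal.ofReal c₂ * redAvgD (p / (p - 1)) (fun x => (W1p x)⁻¹) I e

/-- The `L^p(W)` norm `(∫ |W^{1/p}(x) f(x)|^p dx)^{1/p}` (as a value in `[0,∞]`). -/
def wNorm {d n : ℕ} (p : ℝ) (W1p : (Fin d → ℝ) → Matrix (Fin n) (Fin n) ℂ)
    (f : (Fin d → ℝ) → EuclideanSpace ℂ (Fin n)) : ℝ≥0∞ :=
  (∫⁻ x, ENNReal.ofReal ‖mApp (W1p x) (f x)‖ ^ p) ^ (1 / p)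

/-- The square-function expression
`∑_{I ∈ 𝒟} ∑_{ε ∈ 𝒮} |A_I f_I^ε|² |I|^{-1} χ_I(x)` for a family of matrices `A_I`. -/
def sqFn {d n : ℕ} (A : DCube d → Matrix (Fin n) (Fin n) ℂ)
    (f : (Fin d → ℝ) → EuclideanSpace ℂ (Fin n)) (x : Fin d → ℝ) : ℝ≥0∞ :=
  ∑' I : DCube d, ∑ ε ∈ Sfin d,
    Set.indicator I.set
      (fun _ => ENNReal.ofReal (‖mApp (A I) (haarCoef f I ε)‖ ^ 2) / ENNReal.ofReal I.vol) x

/-! ## Stopping times -/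

/-- A stopping time assigns to each dyadic cube `I` a collection `𝒥 I` of pairwise disjoint
dyadic subcubes of `I`. -/
def IsStopping {d : ℕ} (𝒥 : DCube d → Set (DCube d)) : Prop :=
  ∀ I : DCube d, (∀ J ∈ 𝒥 I, J.set ⊆ I.set) ∧
    (𝒥 I).Pairwise fun J K => Disjoint J.set K.set

/-- `ℱ(I)`: the dyadic subcubes of `I` not contained in any stopping cube `J ∈ 𝒥(I)`. -/
def Fcol {d : ℕ} (𝒥 : DCube d → Set (DCube d)) (I : DCube d) : Set (DCube d) :=
  {J | J.set ⊆ I.set ∧ ∀ K ∈ 𝒥 I, ¬J.set ⊆ K.set}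

/-- A stopping time is admissible if `I ∈ ℱ(I)` for every `I`. -/
def Admissible {d : ℕ} (𝒥 : DCube d → Set (DCube d)) : Prop :=
  ∀ I : DCube d, I ∈ Fcol 𝒥 I

/-- The iterated stopping collections: `𝒥^0(I) = {I}` and
`𝒥^{j+1}(I) = ⋃_{J ∈ 𝒥^j(I)} 𝒥(J)`. -/
def JIter {d : ℕ} (𝒥 : DCube d → Set (DCube d)) : ℕ → DCube d → Set (DCube d)
  | 0, I => {I}
  | j + 1, I => ⋃ J ∈ JIter 𝒥 j I, 𝒥 J

/-- A stopping time is decaying with constant `c` if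
`∑_{J ∈ 𝒥(I)} |J| ≤ c |I|` for every `I`. -/
def Decaying {d : ℕ} (c : ℝ) (𝒥 : DCube d → Set (DCube d)) : Prop :=
  ∀ I : DCube d,
    ∑' J : 𝒥 I, ENNReal.ofReal (J : DCube d).vol ≤ ENNReal.ofReal c * ENNReal.ofReal I.vol

/-- `ℱ^j = ℱ^j(I₀) = ⋃_{J ∈ 𝒥^{j-1}(I₀)} ℱ(J)` (intended for `j ≥ 1`). -/
def Fj {d : ℕ} (𝒥 : DCube d → Set (DCube d)) (I₀ : DCube d) (j : ℕ) : Set (DCube d) :=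
  ⋃ J ∈ JIter 𝒥 (j - 1) I₀, Fcol 𝒥 J

/-- The Haar projection `Δ_j f = ∑_{I ∈ ℱ^j} ∑_{ε ∈ 𝒮} f_I^ε h_I^ε`. -/
def deltaHaar {d n : ℕ} (𝒥 : DCube d → Set (DCube d)) (I₀ : DCube d) (j : ℕ)
    (f : (Fin d → ℝ) → EuclideanSpace ℂ (Fin n)) (x : Fin d → ℝ) :
    EuclideanSpace ℂ (Fin n) :=
  ∑' I : Fj 𝒥 I₀ j, ∑ ε ∈ Sfin d, haarFn (I : DCube d) ε x • haarCoef f (I : DCube d) ε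

/-! ## Constant Haar multipliers -/

/-- `∑_{I ∈ S} ∑_{ε ∈ 𝒮} V_I^{-1} f_I^ε h_I^ε(x)`. -/
def projInv {d n : ℕ} (V : DCube d → Matrix (Fin n) (Fin n) ℂ) (S : Set (DCube d))
    (f : (Fin d → ℝ) → EuclideanSpace ℂ (Fin n)) (x : Fin d → ℝ) :
    EuclideanSpace ℂ (Fin n) :=
  ∑' I : S, ∑ ε ∈ Sfin d,
    haarFn (I : DCube d) ε x • mApp ((V (I : DCube d))⁻¹) (haarCoef f (I : DCube d) ε)

/-- A function has finite Haar expansion if it is a finite sum of Haar functions. -/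
def FiniteHaar {d n : ℕ} (f : (Fin d → ℝ) → EuclideanSpace ℂ (Fin n)) : Prop :=
  ∃ F : Finset (DCube d × (Fin d → Bool)),
    ∀ x, f x = ∑ q ∈ F, haarFn q.1 q.2 x • haarCoef f q.1 q.2

/-! ## The weighted stopping time -/

/-- The stopping condition `‖V_J V_I^{-1}‖^p > λ₁` or `‖V_J^{-1} V_I‖^{p'} > λ₂`. -/
def stopBad {d n : ℕ} (p l₁ l₂ : ℝ) (V : DCube d → Matrix (Fin n) (Fin n) ℂ)
    (J I : DCube d) : Prop :=
  l₁ < matNorm (V J * (V I)⁻¹) ^ p ∨ l₂ < matNorm ((V J)⁻¹ * V I) ^ (p / (p - 1))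

/-- The stopping time `𝒥(I)` = maximal dyadic subcubes `J ⊆ I` satisfying `stopBad`. -/
def stopST {d n : ℕ} (p l₁ l₂ : ℝ) (V : DCube d → Matrix (Fin n) (Fin n) ℂ)
    (I : DCube d) : Set (DCube d) :=
  {J | J.set ⊆ I.set ∧ stopBad p l₁ l₂ V J I ∧
    ∀ K : DCube d, K.set ⊆ I.set → stopBad p l₁ l₂ V K I → J.set ⊆ K.set → K = J}

/-- A twice differentiable function with nonpositive second derivative lies below its tangent. -/
lemma le_tangent_of_deriv2_nonpos {f f' f'' : ℝ → ℝ} (hf : ∀ t, HasDerivAt f (f' t) t)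
    (hf' : ∀ t, HasDerivAt f' (f'' t) t) (h : ∀ t, f'' t ≤ 0) : f 1 ≤ f 0 + f' 0 := by
  have hanti : Antitone f' := by
    apply antitone_of_deriv_nonpos (fun t => (hf' t).differentiableAt)
    intro t
    rw [(hf' t).deriv]
    exact h t
  obtain ⟨c, hc, hc'⟩ := exists_hasDerivAt_eq_slope f f' (zero_lt_one)
    (fun t _ => (hf t).continuousAt.continuousWithinAt) (fun t _ => hf t)
  have := hanti hc.1.le
  simp only [sub_zero, div_one] at hc'
  linarith

/-- The second derivative of a real power of a positive function. -/
lemma hasDerivAt_rpow_mul {g g' : ℝ → ℝ} {g2 r : ℝ} {t : ℝ} (hg : HasDerivAt g (g' t) t)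
    (hg' : HasDerivAt g' g2 t) (hpos : 0 < g t) :
    HasDerivAt (fun t => g' t * r * g t ^ (r - 1))
      (g t ^ (r - 1) * (r * g2 + r * (r - 1) * (g' t ^ 2 / g t))) t := by
  have h1 := (hg'.mul_const r).mul (hg.rpow_const (p := r - 1) (Or.inl hpos.ne'))
  refine h1.congr_deriv ?_
  rw [Real.rpow_sub_one hpos.ne' (r - 1)]
  field_simp

lemma small_exponent_second_derivative_bound {q α σ α1 σ1 h2 σ2 : ℝ} (hq : 1 / 2 < q) (hq1 : q ≤ 1)
    (hα : 0 < α) (hασ : α ≤ σ) (hh : 0 ≤ h2) (hα1 : α1 ^ 2 ≤ 4 * α * h2)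
    (hσ2 : σ2 ≤ 4 * h2) :
    σ ^ (q - 1) * (q * σ2 + q * (q - 1) * (σ1 ^ 2 / σ)) -
      2 / (2 * q - 1) * (α ^ (q - 1) * (q * (2 * h2) + q * (q - 1) * (α1 ^ 2 / α))) ≤ 0 := by
  have hσ : 0 < σ := hα.trans_le hασ
  have hS : σ ^ (q - 1) ≤ α ^ (q - 1) :=
    Real.rpow_le_rpow_of_nonpos hα hασ (by linarith)
  have hS0 : 0 < σ ^ (q - 1) := Real.rpow_pos_of_pos hσ _
  have hT0 : 0 < α ^ (q - 1) := Real.rpow_pos_of_pos hα _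
  have e1 : σ ^ (q - 1) * (q * σ2 + q * (q - 1) * (σ1 ^ 2 / σ)) ≤ α ^ (q - 1) * (4 * q * h2) := by
    calc _ ≤ σ ^ (q - 1) * (4 * q * h2) := by
          gcongr
          have : 0 ≤ σ1 ^ 2 / σ := by positivity
          nlinarith [mul_nonneg (mul_nonneg (by linarith : 0 ≤ q) (by linarith : 0 ≤ 1 - q)) this]
      _ ≤ _ := by
          apply mul_le_mul_of_nonneg_right hS
          have : 0 < q := by linarith
          positivity
  have e2 : α1 ^ 2 / α ≤ 4 * h2 := by
    rw [div_le_iff₀ hα]; linarith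
  have e3 : q * h2 * (4 * q - 2) ≤ q * (2 * h2) + q * (q - 1) * (α1 ^ 2 / α) := by
    nlinarith [mul_le_mul_of_nonneg_left e2
      (mul_nonneg (by linarith : 0 ≤ q) (by linarith : 0 ≤ 1 - q))]
  have hB : 0 < 2 / (2 * q - 1) := div_pos two_pos (by linarith)
  have e4 := mul_le_mul_of_nonneg_left (mul_le_mul_of_nonneg_left e3 hT0.le) hB.le
  have e5 : 2 / (2 * q - 1) * (α ^ (q - 1) * (q * h2 * (4 * q - 2))) =
      α ^ (q - 1) * (4 * q * h2) := by
    have : 2 * q - 1 ≠ 0 := by linarith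
    field_simp
    ring
  linarith

lemma large_exponent_second_derivative_bound {q α σ α1 σ1 h2 σ2 : ℝ} (hq : 1 ≤ q)
    (hα : 0 < α) (hασ : α ≤ σ) (hh : 0 ≤ h2) (hα1 : α1 ^ 2 ≤ 4 * α * h2)
    (hσ1 : σ1 ^ 2 ≤ 8 * σ * h2) (hσ2' : 0 ≤ σ2) (hσ2 : σ2 ≤ 4 * h2) :
    σ ^ (q - 1) * (q * σ2 + q * (q - 1) * (σ1 ^ 2 / σ)) -
      16 * q ^ 2 * (2 * h2 * σ ^ (q - 1) + 2 * (α1 * (σ1 * (q - 1) * σ ^ (q - 1 - 1))) +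
        α * (σ ^ (q - 1 - 1) * ((q - 1) * σ2 + (q - 1) * (q - 1 - 1) * (σ1 ^ 2 / σ)))) -
      320 * q ^ 3 * (80 * q ^ 2) ^ (q - 1) *
        (α ^ (q - 1) * (q * (2 * h2) + q * (q - 1) * (α1 ^ 2 / α))) ≤ 0 := by
  have hσ : 0 < σ := hα.trans_le hασ
  have hq0 : 0 < q := by linarith
  rw [Real.rpow_sub_one hσ.ne' (q - 1)]
  have hαS : α ^ (q - 1) = σ ^ (q - 1) * (α / σ) ^ (q - 1) := by
    rw [← Real.mul_rpow hσ.le (by positivity), mul_div_cancel₀ _ hσ.ne']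
  have hS0 : 0 < σ ^ (q - 1) := Real.rpow_pos_of_pos hσ _
  have hr0 : 0 < α / σ := by positivity
  have hr1 : α / σ ≤ 1 := by rw [div_le_one hσ]; exact hασ
  have u1 : σ1 ^ 2 / σ ≤ 8 * h2 := by rw [div_le_iff₀ hσ]; linarith
  have u1' : 0 ≤ σ1 ^ 2 / σ := by positivity
  have u2 : 0 ≤ α1 ^ 2 / α := by positivity
  have key : 8 * q ^ 2 * (80 * q ^ 2 * (α / σ) - 1) ≤
      2 * q * (320 * q ^ 3 * (80 * q ^ 2) ^ (q - 1)) * (α / σ) ^ (q - 1) := by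
    rcases le_total (80 * q ^ 2 * (α / σ)) 1 with h | h
    · have : 0 ≤ 2 * q * (320 * q ^ 3 * (80 * q ^ 2) ^ (q - 1)) * (α / σ) ^ (q - 1) := by positivity
      nlinarith [sq_nonneg q]
    · have h3 : 1 ≤ (80 * q ^ 2) ^ (q - 1) * (α / σ) ^ (q - 1) := by
        rw [← Real.mul_rpow (by positivity) hr0.le]
        exact Real.one_le_rpow h (by linarith)
      have h4 : 8 * q ^ 2 * (80 * q ^ 2 * (α / σ) - 1) ≤ 640 * q ^ 4 := by
        have : 0 ≤ q ^ 4 * (1 - α / σ) := mul_nonneg (by positivity) (by linarith)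
        nlinarith [sq_nonneg q]
      have h5 : 640 * q ^ 4 * 1 ≤ 640 * q ^ 4 * ((80 * q ^ 2) ^ (q - 1) * (α / σ) ^ (q - 1)) := by
        gcongr
      linarith
  have b1 : q * σ2 + q * (q - 1) * (σ1 ^ 2 / σ) ≤ 8 * q ^ 2 * h2 := by
    have := mul_le_mul_of_nonneg_left u1 (mul_nonneg hq0.le (by linarith : 0 ≤ q - 1))
    have := mul_le_mul_of_nonneg_left hσ2 hq0.le
    nlinarith [mul_nonneg hq0.le hh]
  have b2 : -(2 * (α1 * σ1 * (q - 1) / σ)) ≤ h2 * (1 + 32 * q ^ 2 * (α / σ)) := by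
    have y : -(2 * (α1 * σ1)) ≤ 8 * q * α1 ^ 2 + σ1 ^ 2 / (8 * q) := by
      have : 0 ≤ (8 * q * α1 + σ1) ^ 2 / (8 * q) := by positivity
      have e : (8 * q * α1 + σ1) ^ 2 / (8 * q) =
          8 * q * α1 ^ 2 + σ1 ^ 2 / (8 * q) + 2 * (α1 * σ1) := by
        field_simp; ring
      linarith
    have y1 : σ1 ^ 2 / (8 * q) ≤ σ * h2 / q := by
      rw [div_le_div_iff₀ (by positivity) hq0]; nlinarith
    have y2 : -(2 * (α1 * σ1)) * (q - 1) ≤ (32 * q * (α * h2) + σ * h2 / q) * (q - 1) := by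
      apply mul_le_mul_of_nonneg_right _ (by linarith)
      nlinarith
    have y3 : (32 * q * (α * h2) + σ * h2 / q) * (q - 1) ≤ 32 * q ^ 2 * (α * h2) + σ * h2 := by
      have e : (32 * q * (α * h2) + σ * h2 / q) * (q - 1) =
        32 * q ^ 2 * (α * h2) + σ * h2 - (32 * q * (α * h2) + σ * h2 / q) := by
        field_simp
      have : 0 ≤ 32 * q * (α * h2) + σ * h2 / q := by positivity
      linarith
    have e : -(2 * (α1 * σ1 * (q - 1) / σ)) = (-(2 * (α1 * σ1)) * (q - 1)) / σ := by ring
    rw [e, div_le_iff₀ hσ]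
    have e' : h2 * (1 + 32 * q ^ 2 * (α / σ)) * σ = 32 * q ^ 2 * (α * h2) + σ * h2 := by
      field_simp; ring
    linarith
  have b3 : -(α / σ * ((q - 1) * σ2 + (q - 1) * (q - 1 - 1) * (σ1 ^ 2 / σ))) ≤
      8 * q ^ 2 * h2 * (α / σ) := by
    have h6 : -(8 * q ^ 2 * h2) ≤ (q - 1) * σ2 + (q - 1) * (q - 1 - 1) * (σ1 ^ 2 / σ) := by
      have : 0 ≤ (q - 1) * σ2 := mul_nonneg (by linarith) hσ2'
      have : 0 ≤ (q - 1) ^ 2 * (σ1 ^ 2 / σ) := by positivity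
      have := mul_le_mul_of_nonneg_left u1 (by linarith : 0 ≤ q - 1)
      have : (q - 1) * h2 ≤ q ^ 2 * h2 := by
        apply mul_le_mul_of_nonneg_right _ hh
        nlinarith
      nlinarith
    nlinarith [mul_le_mul_of_nonneg_left h6 hr0.le]
  have b4 : q * (2 * h2) ≤ q * (2 * h2) + q * (q - 1) * (α1 ^ 2 / α) := by
    have : 0 ≤ q * (q - 1) * (α1 ^ 2 / α) :=
      mul_nonneg (mul_nonneg hq0.le (by linarith)) u2
    linarith
  have hB0 : 0 < 320 * q ^ 3 * (80 * q ^ 2) ^ (q - 1) := by positivity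
  set B := 320 * q ^ 3 * (80 * q ^ 2) ^ (q - 1)
  set S := σ ^ (q - 1)
  set R := (α / σ) ^ (q - 1)
  have hR0 : 0 < R := Real.rpow_pos_of_pos hr0 _
  have c1 := mul_le_mul_of_nonneg_left b1 hS0.le
  have c2 := mul_le_mul_of_nonneg_left (add_le_add b2 b3) (by positivity : 0 ≤ 16 * q ^ 2 * S)
  have c3 := mul_le_mul_of_nonneg_left b4 (by positivity : 0 ≤ B * (S * R))
  have c4 := mul_le_mul_of_nonneg_left key (by positivity : 0 ≤ S * h2)
  rw [hαS]
  have e1 : 16 * q ^ 2 * S * (-(2 * (α1 * σ1 * (q - 1) / σ)) +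
      -(α / σ * ((q - 1) * σ2 + (q - 1) * (q - 1 - 1) * (σ1 ^ 2 / σ)))) =
      - (16 * q ^ 2 * (2 * (α1 * (σ1 * (q - 1) * (S / σ))) +
        α * (S / σ * ((q - 1) * σ2 + (q - 1) * (q - 1 - 1) * (σ1 ^ 2 / σ))))) := by
    ring
  rw [e1] at c2
  nlinarith

section Bellman

variable {H : Type*} [NormedAddCommGroup H] [InnerProductSpace ℝ H]

lemma norm_add_smul_sq (x h : H) (t : ℝ) :
    ‖x + t • h‖ ^ 2 = ‖x‖ ^ 2 + t * (2 * inner ℝ x h) + t ^ 2 * ‖h‖ ^ 2 := by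
  rw [norm_add_sq_real, inner_smul_right, norm_smul, mul_pow, Real.norm_eq_abs, sq_abs]
  ring

lemma hasDerivAt_norm_add_smul_sq (x h : H) (t : ℝ) :
    HasDerivAt (fun t : ℝ => ‖x + t • h‖ ^ 2) (2 * inner ℝ (x + t • h) h) t := by
  have : (fun t : ℝ => ‖x + t • h‖ ^ 2) =
      fun t => ‖x‖ ^ 2 + t * (2 * inner ℝ x h) + t ^ 2 * ‖h‖ ^ 2 := by
    ext t; exact norm_add_smul_sq x h t
  rw [this]
  have := (((hasDerivAt_id t).mul_const (2 * inner ℝ x h)).const_add (‖x‖ ^ 2)).add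
    (((hasDerivAt_id t).pow 2).mul_const (‖h‖ ^ 2))
  refine this.congr_deriv ?_
  rw [inner_add_left, inner_smul_left, real_inner_self_eq_norm_sq]
  simp
  ring

lemma hasDerivAt_inner_add_smul (x h : H) (t : ℝ) :
    HasDerivAt (fun t : ℝ => 2 * inner ℝ (x + t • h) h) (2 * ‖h‖ ^ 2) t := by
  have : (fun t : ℝ => 2 * inner ℝ (x + t • h) h) =
      fun t => 2 * (inner ℝ x h + t * ‖h‖ ^ 2) := by
    ext t
    rw [inner_add_left, inner_smul_left, real_inner_self_eq_norm_sq]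
    simp
  rw [this]
  exact ((((hasDerivAt_id t).mul_const (‖h‖ ^ 2)).const_add (inner ℝ x h)).const_mul 2).congr_deriv
    (by simp)

lemma sq_two_mul_inner_le (x h : H) : (2 * inner ℝ x h) ^ 2 ≤ 4 * ‖x‖ ^ 2 * ‖h‖ ^ 2 := by
  have := abs_le.1 (abs_real_inner_le_norm x h)
  have : (inner ℝ x h) ^ 2 ≤ (‖x‖ * ‖h‖) ^ 2 := sq_le_sq' this.1 this.2
  nlinarith

lemma sq_sum_inner_le {x h y k : H} {ε : ℝ} (hε : 0 ≤ ε) (hk : ‖k‖ ≤ ‖h‖) :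
    (2 * inner ℝ x h + 2 * inner ℝ y k) ^ 2 ≤ 8 * (ε + ‖x‖ ^ 2 + ‖y‖ ^ 2) * ‖h‖ ^ 2 := by
  have h1 := sq_two_mul_inner_le x h
  have h2 := sq_two_mul_inner_le y k
  have h3 : ‖k‖ ^ 2 ≤ ‖h‖ ^ 2 := by gcongr
  have h4 := mul_le_mul_of_nonneg_left h3 (sq_nonneg ‖y‖)
  nlinarith [sq_nonneg (2 * inner ℝ x h - 2 * inner ℝ y k), mul_nonneg hε (sq_nonneg ‖h‖)]

/-- Step inequality of a Burkholder function for exponents at most two. -/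
lemma bellman_small_exponent_step {q ε : ℝ} (hq : 1 / 2 < q) (hq1 : q ≤ 1) (hε : 0 < ε)
    (x y h k : H)
    (hk : ‖k‖ ≤ ‖h‖) :
    (ε + ‖x + h‖ ^ 2 + ‖y + k‖ ^ 2) ^ q - 2 / (2 * q - 1) * (ε + ‖x + h‖ ^ 2) ^ q ≤
      (ε + ‖x‖ ^ 2 + ‖y‖ ^ 2) ^ q - 2 / (2 * q - 1) * (ε + ‖x‖ ^ 2) ^ q +
      ((2 * inner ℝ x h + 2 * inner ℝ y k) * q * (ε + ‖x‖ ^ 2 + ‖y‖ ^ 2) ^ (q - 1) -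
        2 / (2 * q - 1) * (2 * inner ℝ x h * q * (ε + ‖x‖ ^ 2) ^ (q - 1))) := by
  have hα : ∀ t : ℝ, 0 < ε + ‖x + t • h‖ ^ 2 := fun t => by positivity
  have hσ : ∀ t : ℝ, 0 < ε + ‖x + t • h‖ ^ 2 + ‖y + t • k‖ ^ 2 := fun t => by positivity
  have dα : ∀ t : ℝ, HasDerivAt (fun t : ℝ => ε + ‖x + t • h‖ ^ 2)
      (2 * inner ℝ (x + t • h) h) t :=
    fun t => (hasDerivAt_norm_add_smul_sq x h t).const_add ε
  have dσ : ∀ t : ℝ, HasDerivAt (fun t : ℝ => ε + ‖x + t • h‖ ^ 2 + ‖y + t • k‖ ^ 2)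
      (2 * inner ℝ (x + t • h) h + 2 * inner ℝ (y + t • k) k) t :=
    fun t => (dα t).add (hasDerivAt_norm_add_smul_sq y k t)
  have dα2 := hasDerivAt_inner_add_smul x h
  have dσ2 : ∀ t : ℝ, HasDerivAt
      (fun t : ℝ => 2 * inner ℝ (x + t • h) h + 2 * inner ℝ (y + t • k) k)
      (2 * ‖h‖ ^ 2 + 2 * ‖k‖ ^ 2) t :=
    fun t => (dα2 t).add (hasDerivAt_inner_add_smul y k t)
  have main := le_tangent_of_deriv2_nonpos
    (fun t => ((dσ t).rpow_const (p := q) (Or.inl (hσ t).ne')).sub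
      (((dα t).rpow_const (p := q) (Or.inl (hα t).ne')).const_mul (2 / (2 * q - 1))))
    (fun t => (hasDerivAt_rpow_mul (r := q) (dσ t) (dσ2 t) (hσ t)).sub
      ((hasDerivAt_rpow_mul (r := q) (dα t) (dα2 t) (hα t)).const_mul (2 / (2 * q - 1))))
    (fun t => small_exponent_second_derivative_bound hq hq1 (hα t)
      (by linarith [sq_nonneg ‖y + t • k‖]) (sq_nonneg ‖h‖)
      ((sq_two_mul_inner_le _ _).trans (by
        nlinarith [mul_nonneg hε.le (sq_nonneg ‖h‖)]))
      (by have : ‖k‖ ^ 2 ≤ ‖h‖ ^ 2 := by gcongr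
          linarith))
  simpa using main

/-- Step inequality of a Burkholder function for exponents at least two. -/
lemma bellman_large_exponent_step {q ε : ℝ} (hq : 1 ≤ q) (hε : 0 < ε)
    (x y h k : H)
    (hk : ‖k‖ ≤ ‖h‖) :
    (ε + ‖x + h‖ ^ 2 + ‖y + k‖ ^ 2) ^ q -
        16 * q ^ 2 * ((ε + ‖x + h‖ ^ 2) * (ε + ‖x + h‖ ^ 2 + ‖y + k‖ ^ 2) ^ (q - 1)) -
        320 * q ^ 3 * (80 * q ^ 2) ^ (q - 1) * (ε + ‖x + h‖ ^ 2) ^ q ≤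
      (ε + ‖x‖ ^ 2 + ‖y‖ ^ 2) ^ q -
        16 * q ^ 2 * ((ε + ‖x‖ ^ 2) * (ε + ‖x‖ ^ 2 + ‖y‖ ^ 2) ^ (q - 1)) -
        320 * q ^ 3 * (80 * q ^ 2) ^ (q - 1) * (ε + ‖x‖ ^ 2) ^ q +
      ((2 * inner ℝ x h + 2 * inner ℝ y k) * q * (ε + ‖x‖ ^ 2 + ‖y‖ ^ 2) ^ (q - 1) -
        16 * q ^ 2 * (2 * inner ℝ x h * (ε + ‖x‖ ^ 2 + ‖y‖ ^ 2) ^ (q - 1) +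
          (ε + ‖x‖ ^ 2) * ((2 * inner ℝ x h + 2 * inner ℝ y k) * (q - 1) *
            (ε + ‖x‖ ^ 2 + ‖y‖ ^ 2) ^ (q - 1 - 1))) -
        320 * q ^ 3 * (80 * q ^ 2) ^ (q - 1) *
          (2 * inner ℝ x h * q * (ε + ‖x‖ ^ 2) ^ (q - 1))) := by
  have hα : ∀ t : ℝ, 0 < ε + ‖x + t • h‖ ^ 2 := fun t => by positivity
  have hσ : ∀ t : ℝ, 0 < ε + ‖x + t • h‖ ^ 2 + ‖y + t • k‖ ^ 2 := fun t => by positivity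
  have dα : ∀ t : ℝ, HasDerivAt (fun t : ℝ => ε + ‖x + t • h‖ ^ 2)
      (2 * inner ℝ (x + t • h) h) t :=
    fun t => (hasDerivAt_norm_add_smul_sq x h t).const_add ε
  have dσ : ∀ t : ℝ, HasDerivAt (fun t : ℝ => ε + ‖x + t • h‖ ^ 2 + ‖y + t • k‖ ^ 2)
      (2 * inner ℝ (x + t • h) h + 2 * inner ℝ (y + t • k) k) t :=
    fun t => (dα t).add (hasDerivAt_norm_add_smul_sq y k t)
  have dα2 := hasDerivAt_inner_add_smul x h
  have dσ2 : ∀ t : ℝ, HasDerivAt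
      (fun t : ℝ => 2 * inner ℝ (x + t • h) h + 2 * inner ℝ (y + t • k) k)
      (2 * ‖h‖ ^ 2 + 2 * ‖k‖ ^ 2) t :=
    fun t => (dα2 t).add (hasDerivAt_inner_add_smul y k t)
  have dp : ∀ (r t : ℝ), HasDerivAt
      (fun t : ℝ => (ε + ‖x + t • h‖ ^ 2 + ‖y + t • k‖ ^ 2) ^ r)
      ((2 * inner ℝ (x + t • h) h + 2 * inner ℝ (y + t • k) k) * r *
        (ε + ‖x + t • h‖ ^ 2 + ‖y + t • k‖ ^ 2) ^ (r - 1)) t :=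
    fun r t => (dσ t).rpow_const (p := r) (Or.inl (hσ t).ne')
  have dp2 := fun (r t : ℝ) => hasDerivAt_rpow_mul (r := r) (dσ t) (dσ2 t) (hσ t)
  have main := le_tangent_of_deriv2_nonpos
    (fun t => ((dp q t).sub (((dα t).mul (dp (q - 1) t)).const_mul (16 * q ^ 2))).sub
      (((dα t).rpow_const (p := q) (Or.inl (hα t).ne')).const_mul
        (320 * q ^ 3 * (80 * q ^ 2) ^ (q - 1))))
    (fun t => ((dp2 q t).sub ((((dα2 t).mul (dp (q - 1) t)).add
        ((dα t).mul (dp2 (q - 1) t))).const_mul (16 * q ^ 2))).sub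
      ((hasDerivAt_rpow_mul (r := q) (dα t) (dα2 t) (hα t)).const_mul
        (320 * q ^ 3 * (80 * q ^ 2) ^ (q - 1))))
    (fun t => by
      have hk2 : ‖k‖ ^ 2 ≤ ‖h‖ ^ 2 := by gcongr
      have := large_exponent_second_derivative_bound (q := q) (α := ε + ‖x + t • h‖ ^ 2)
        (σ := ε + ‖x + t • h‖ ^ 2 + ‖y + t • k‖ ^ 2) (α1 := 2 * inner ℝ (x + t • h) h)
        (σ1 := 2 * inner ℝ (x + t • h) h + 2 * inner ℝ (y + t • k) k) (h2 := ‖h‖ ^ 2)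
        (σ2 := 2 * ‖h‖ ^ 2 + 2 * ‖k‖ ^ 2) hq (hα t)
        (by linarith [sq_nonneg ‖y + t • k‖]) (sq_nonneg ‖h‖)
        ((sq_two_mul_inner_le _ _).trans (by
          nlinarith [mul_nonneg hε.le (sq_nonneg ‖h‖)]))
        (sq_sum_inner_le hε.le hk) (by positivity) (by linarith)
      refine le_of_eq_of_le ?_ this
      ring)
  simpa using main

lemma mul_rpow_sub_one_le {A a s q : ℝ} (hA : 1 ≤ A) (ha : 0 ≤ a) (hs : 0 < s)
    (hq : 1 ≤ q) :
    A * (a * s ^ (q - 1)) ≤ s ^ q / 2 + A * (2 * A) ^ (q - 1) * a ^ q := by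
  have hsq : s ^ q = s * s ^ (q - 1) := by
    rw [Real.rpow_sub_one hs.ne']; field_simp
  have hS : 0 < s ^ (q - 1) := Real.rpow_pos_of_pos hs _
  rcases le_total (2 * A * a) s with h | h
  · have : 0 ≤ A * (2 * A) ^ (q - 1) * a ^ q := by positivity
    rw [hsq]
    nlinarith [mul_le_mul_of_nonneg_right h hS.le]
  · have ha' : 0 < a := by
      by_contra hcon
      have : a = 0 := le_antisymm (not_lt.1 hcon) ha
      subst this
      linarith [hs.trans_le h]
    have h1 : s ^ (q - 1) ≤ (2 * A * a) ^ (q - 1) :=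
      Real.rpow_le_rpow hs.le h (by linarith)
    rw [Real.mul_rpow (by positivity) ha] at h1
    have haq : a ^ q = a * a ^ (q - 1) := by
      rw [Real.rpow_sub_one ha'.ne']; field_simp
    have h2 : A * (a * s ^ (q - 1)) ≤ A * (a * ((2 * A) ^ (q - 1) * a ^ (q - 1))) := by
      gcongr
    have h3 : 0 ≤ s ^ q / 2 := by positivity
    rw [haq]
    linarith

lemma add_sq_rpow_half_le {p δ u : ℝ} (hp : 0 < p) (hδ : 0 < δ) (hu : 0 ≤ u) :
    (δ ^ (2 / p) + u ^ 2) ^ (p / 2) ≤ 2 ^ (p / 2) * (δ + u ^ p) := by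
  have e1 : (δ ^ (2 / p)) ^ (p / 2) = δ := by
    rw [← Real.rpow_mul hδ.le]
    have : 2 / p * (p / 2) = 1 := by field_simp
    rw [this, Real.rpow_one]
  have e2 : (u ^ 2) ^ (p / 2) = u ^ p := by
    rw [← Real.rpow_natCast, ← Real.rpow_mul hu]
    congr 1; push_cast; ring
  have h0 : 0 < δ ^ (2 / p) := Real.rpow_pos_of_pos hδ _
  rcases le_total (δ ^ (2 / p)) (u ^ 2) with h | h
  · calc _ ≤ (2 * u ^ 2) ^ (p / 2) := by gcongr; linarith
      _ = 2 ^ (p / 2) * u ^ p := by rw [Real.mul_rpow (by norm_num) (by positivity), e2]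
      _ ≤ _ := by gcongr; linarith
  · calc _ ≤ (2 * δ ^ (2 / p)) ^ (p / 2) := by gcongr; linarith
      _ = 2 ^ (p / 2) * δ := by rw [Real.mul_rpow (by norm_num) (by positivity), e1]
      _ ≤ _ := by
        gcongr
        have := Real.rpow_nonneg hu p
        linarith

/-- Existence of a Burkholder function: a majorant of `‖y‖ ^ p - C ‖x‖ ^ p` that decreases on
average along differentially subordinate martingale steps. -/
lemma exists_bellman {p : ℝ} (hp : 1 < p) : ∃ C : ℝ, 0 < C ∧ ∀ δ : ℝ, 0 < δ →
    ∃ U : H → H → ℝ, U 0 0 ≤ 0 ∧ (∀ x y, ‖y‖ ^ p ≤ U x y + C * (δ + ‖x‖ ^ p)) ∧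
      ∀ (ι : Type) [Fintype ι] (x y : H) (h k : ι → H), ∑ i, h i = 0 → ∑ i, k i = 0 →
        (∀ i, ‖k i‖ ≤ ‖h i‖) → ∑ i, U (x + h i) (y + k i) ≤ Fintype.card ι * U x y := by
  have hp0 : 0 < p := by linarith
  have hyp : ∀ (ε : ℝ) (x y : H), 0 < ε → ‖y‖ ^ p ≤ (ε + ‖x‖ ^ 2 + ‖y‖ ^ 2) ^ (p / 2) := by
    intro ε x y hε
    have e2 : (‖y‖ ^ 2) ^ (p / 2) = ‖y‖ ^ p := by
      rw [← Real.rpow_natCast, ← Real.rpow_mul (norm_nonneg _)]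
      congr 1; push_cast; ring
    rw [← e2]
    gcongr
    nlinarith [sq_nonneg ‖x‖]
  have hsum : ∀ (ι : Type) [Fintype ι] (x : H) (h : ι → H), ∑ i, h i = 0 →
      ∑ i, inner ℝ x (h i) = 0 := by
    intro ι _ x h hh
    rw [← inner_sum, hh, inner_zero_right]
  rcases le_total p 2 with h2 | h2
  · have hB0 : 0 < 2 / (2 * (p / 2) - 1) := div_pos two_pos (by linarith)
    have hB1 : 1 ≤ 2 / (2 * (p / 2) - 1) := by rw [le_div_iff₀ (by linarith)]; linarith
    refine ⟨2 / (2 * (p / 2) - 1) * 2 ^ (p / 2), by positivity, fun δ hδ => ?_⟩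
    have hε : 0 < δ ^ (2 / p) := Real.rpow_pos_of_pos hδ _
    refine ⟨fun x y => (δ ^ (2 / p) + ‖x‖ ^ 2 + ‖y‖ ^ 2) ^ (p / 2) -
      2 / (2 * (p / 2) - 1) * (δ ^ (2 / p) + ‖x‖ ^ 2) ^ (p / 2), ?_, ?_, ?_⟩
    · have : 0 < (δ ^ (2 / p)) ^ (p / 2) := Real.rpow_pos_of_pos hε _
      simp only [norm_zero, ne_eq, OfNat.ofNat_ne_zero, not_false_eq_true, zero_pow, add_zero]
      nlinarith
    · intro x y
      have e1 := hyp _ x y hε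
      have e2 := mul_le_mul_of_nonneg_left
        (add_sq_rpow_half_le hp0 hδ (norm_nonneg x)) hB0.le
      dsimp only
      linarith
    · intro ι _ x y h k hh hk hhk
      have := Finset.sum_le_sum fun i (_ : i ∈ Finset.univ) =>
        bellman_small_exponent_step (q := p / 2) (by linarith) (by linarith) hε x y (h i) (k i)
          (hhk i)
      refine this.trans (le_of_eq ?_)
      rw [Finset.sum_add_distrib]
      simp only [Finset.sum_sub_distrib, ← Finset.mul_sum, ← Finset.sum_mul,
        Finset.sum_add_distrib, hsum ι x h hh, hsum ι y k hk, Finset.sum_const, Finset.card_univ,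
        nsmul_eq_mul]
      ring
  · set q := p / 2 with hq
    have hq1 : 1 ≤ q := by rw [hq]; linarith
    have hA1 : 1 ≤ 16 * q ^ 2 := by nlinarith
    set B := 320 * q ^ 3 * (80 * q ^ 2) ^ (q - 1) with hB
    have hB0 : 0 < B := by positivity
    set D := 16 * q ^ 2 * (2 * (16 * q ^ 2)) ^ (q - 1) with hD
    have hD0 : 0 < D := by positivity
    refine ⟨2 * (B + D) * 2 ^ q, by positivity, fun δ hδ => ?_⟩
    have hε : 0 < δ ^ (2 / p) := Real.rpow_pos_of_pos hδ _
    refine ⟨fun x y => 2 * ((δ ^ (2 / p) + ‖x‖ ^ 2 + ‖y‖ ^ 2) ^ q -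
      16 * q ^ 2 * ((δ ^ (2 / p) + ‖x‖ ^ 2) * (δ ^ (2 / p) + ‖x‖ ^ 2 + ‖y‖ ^ 2) ^ (q - 1)) -
      B * (δ ^ (2 / p) + ‖x‖ ^ 2) ^ q), ?_, ?_, ?_⟩
    · have h3 : 0 < (δ ^ (2 / p)) ^ q := Real.rpow_pos_of_pos hε _
      have h4 : δ ^ (2 / p) * (δ ^ (2 / p)) ^ (q - 1) = (δ ^ (2 / p)) ^ q := by
        rw [Real.rpow_sub_one hε.ne']; field_simp
      simp only [norm_zero, ne_eq, OfNat.ofNat_ne_zero, not_false_eq_true, zero_pow, add_zero, h4]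
      nlinarith [mul_pos hB0 h3]
    · intro x y
      have e1 := hyp _ x y hε
      have e2 := mul_le_mul_of_nonneg_left
        (add_sq_rpow_half_le hp0 hδ (norm_nonneg x)) (by positivity : 0 ≤ 2 * (B + D))
      have e3 := mul_rpow_sub_one_le (A := 16 * q ^ 2) (a := δ ^ (2 / p) + ‖x‖ ^ 2)
        (s := δ ^ (2 / p) + ‖x‖ ^ 2 + ‖y‖ ^ 2) hA1 (by positivity) (by positivity) hq1
      dsimp only
      linarith
    · intro ι _ x y h k hh hk hhk
      have := Finset.sum_le_sum fun i (_ : i ∈ Finset.univ) =>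
        bellman_large_exponent_step (q := q) hq1 hε x y (h i) (k i) (hhk i)
      rw [← Finset.mul_sum]
      refine (mul_le_mul_of_nonneg_left this two_pos.le).trans (le_of_eq ?_)
      rw [Finset.sum_add_distrib]
      simp only [Finset.sum_sub_distrib, ← Finset.mul_sum, ← Finset.sum_mul,
        Finset.sum_add_distrib, hsum ι x h hh, hsum ι y k hk, Finset.sum_const, Finset.card_univ,
        nsmul_eq_mul]
      ring

end Bellman

/-! ## Dyadic indices -/

/-- The index of the dyadic interval of length `2 ^ k` containing `t`. -/
def dyadicIdx (k : ℤ) (t : ℝ) : ℤ := ⌊t / 2 ^ k⌋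

lemma dyadicIdx_eq_iff {k m : ℤ} {t : ℝ} :
    dyadicIdx k t = m ↔ (m : ℝ) * 2 ^ k ≤ t ∧ t < ((m : ℝ) + 1) * 2 ^ k := by
  have : (0 : ℝ) < 2 ^ k := by positivity
  rw [dyadicIdx, Int.floor_eq_iff, le_div_iff₀ this, div_lt_iff₀ this]

lemma dyadicIdx_succ (k : ℤ) (t : ℝ) : dyadicIdx (k + 1) t = dyadicIdx k t / 2 := by
  have h := Int.floor_div_natCast (t / 2 ^ k) 2
  rw [dyadicIdx, dyadicIdx, zpow_add_one₀ two_ne_zero, ← div_div]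
  exact_mod_cast h

lemma dyadicIdx_coarsen {k l : ℤ} {s t : ℝ} (hkl : k ≤ l) (h : dyadicIdx k s = dyadicIdx k t) :
    dyadicIdx l s = dyadicIdx l t := by
  induction l, hkl using Int.leInduction with
  | base => exact h
  | succ l _ ih => rw [dyadicIdx_succ, dyadicIdx_succ, ih]

lemma dyadicIdx_corner (k m : ℤ) : dyadicIdx k ((m : ℝ) * 2 ^ k) = m := by
  have : (0 : ℝ) < 2 ^ k := by positivity
  rw [dyadicIdx_eq_iff]
  constructor <;> nlinarith

/-! ## Dyadic cubes -/

namespace DCube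

variable {d : ℕ}

lemma eq_of_k_m {I J : DCube d} (hk : I.k = J.k) (hm : I.m = J.m) : I = J := by
  cases I; cases J; simp_all

instance : Countable (DCube d) := by
  refine Function.Injective.countable (f := fun I : DCube d => (I.k, I.m)) ?_
  intro I J h
  simp only [Prod.mk.injEq] at h
  exact eq_of_k_m h.1 h.2

/-- The dyadic cube of scale `k` containing `z`. -/
def cubeAt (k : ℤ) (z : Fin d → ℝ) : DCube d := ⟨k, fun i => dyadicIdx k (z i)⟩

@[simp] lemma cubeAt_k (k : ℤ) (z : Fin d → ℝ) : (DCube.cubeAt k z).k = k := rfl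

lemma mem_set_iff {I : DCube d} {z : Fin d → ℝ} : z ∈ I.set ↔ DCube.cubeAt I.k z = I := by
  constructor
  · intro h
    exact eq_of_k_m rfl (funext fun i => dyadicIdx_eq_iff.2 (h i))
  · intro h i
    exact dyadicIdx_eq_iff.1 (congrFun (congrArg DCube.m h) i)

lemma mem_cubeAt (k : ℤ) (z : Fin d → ℝ) : z ∈ (DCube.cubeAt k z).set := mem_set_iff.2 rfl

lemma corner_mem (I : DCube d) : I.corner ∈ I.set :=
  mem_set_iff.2 (eq_of_k_m rfl (funext fun i => dyadicIdx_corner I.k (I.m i)))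

lemma cubeAt_coarsen {k l : ℤ} {y z : Fin d → ℝ} (hkl : k ≤ l)
    (h : DCube.cubeAt k y = DCube.cubeAt k z) :
    DCube.cubeAt l y = DCube.cubeAt l z :=
  eq_of_k_m rfl (funext fun i => dyadicIdx_coarsen hkl (congrFun (congrArg DCube.m h) i))

lemma subset_of_mem {I J : DCube d} {z : Fin d → ℝ} (hI : z ∈ I.set) (hJ : z ∈ J.set)
    (hk : I.k ≤ J.k) : I.set ⊆ J.set := by
  intro y hy
  rw [mem_set_iff] at *
  rw [cubeAt_coarsen hk (hy.trans hI.symm), hJ]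

lemma eq_of_mem {I J : DCube d} {z : Fin d → ℝ} (hI : z ∈ I.set) (hJ : z ∈ J.set)
    (hk : I.k = J.k) : I = J := by
  rw [mem_set_iff] at *
  rw [← hI, ← hJ, hk]

lemma k_le_of_subset (hd : 0 < d) {I J : DCube d} (h : I.set ⊆ J.set) : I.k ≤ J.k := by
  by_contra hlt
  push Not at hlt
  have hc := mem_set_iff.1 (h I.corner_mem)
  have hJ : (0 : ℝ) < 2 ^ J.k := by positivity
  have hz : (fun i => I.corner i + 2 ^ J.k) ∈ I.set := by
    intro i
    have : (2 : ℝ) ^ J.k < 2 ^ I.k := zpow_lt_zpow_right₀ (by norm_num) hlt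
    simp only [corner]
    constructor <;> nlinarith
  have hz' := mem_set_iff.1 (h hz)
  have h1 := congrFun (congrArg DCube.m (hc.trans hz'.symm)) ⟨0, hd⟩
  simp only [DCube.cubeAt, dyadicIdx] at h1
  rw [add_div, div_self hJ.ne', Int.floor_add_one] at h1
  linarith

lemma vol_pos (I : DCube d) : 0 < I.vol := by unfold vol; positivity

lemma set_eq_pi (I : DCube d) :
    I.set = Set.univ.pi fun i => Set.Ico ((I.m i : ℝ) * 2 ^ I.k) (((I.m i : ℝ) + 1) * 2 ^ I.k) := by
  ext x; simp [set]

lemma measurableSet_set (I : DCube d) : MeasurableSet I.set := by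
  rw [set_eq_pi]
  exact MeasurableSet.univ_pi fun i => measurableSet_Ico

lemma volume_set (I : DCube d) : volume I.set = ENNReal.ofReal I.vol := by
  rw [set_eq_pi, Real.volume_pi_Ico, vol, ENNReal.ofReal_pow (by positivity)]
  have : ∀ i, ((I.m i : ℝ) + 1) * 2 ^ I.k - I.m i * 2 ^ I.k = 2 ^ I.k := fun i => by ring
  simp [this]

/-- The dyadic children of a cube. -/
def child (I : DCube d) (δ : Fin d → Bool) : DCube d :=
  ⟨I.k - 1, fun i => 2 * I.m i + if δ i then 1 else 0⟩

@[simp] lemma child_k (I : DCube d) (δ : Fin d → Bool) : (I.child δ).k = I.k - 1 := rfl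

lemma child_vol (I : DCube d) (δ : Fin d → Bool) : I.vol = 2 ^ d * (I.child δ).vol := by
  rw [vol, vol, child_k, ← mul_pow, zpow_sub_one₀ two_ne_zero]
  congr 1
  field_simp

lemma child_injective (I : DCube d) : Function.Injective I.child := by
  intro δ δ' h
  ext i
  have h1 := congrFun (congrArg DCube.m h) i
  simp only [child] at h1
  cases h2 : δ i <;> cases h3 : δ' i <;> simp [h2, h3] at h1 ⊢

lemma child_set_subset (I : DCube d) (δ : Fin d → Bool) : (I.child δ).set ⊆ I.set := by
  intro z hz
  rw [mem_set_iff] at *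
  refine eq_of_k_m rfl (funext fun i => ?_)
  have h1 := congrFun (congrArg DCube.m hz) i
  simp only [DCube.cubeAt, child] at h1 ⊢
  have h2 := dyadicIdx_succ (I.k - 1) (z i)
  rw [sub_add_cancel, h1] at h2
  rw [h2]
  split_ifs <;> omega

lemma exists_cubeAt_eq_child {I : DCube d} {z : Fin d → ℝ} (hz : z ∈ I.set) :
    ∃ δ, DCube.cubeAt (I.k - 1) z = I.child δ := by
  rw [mem_set_iff] at hz
  refine ⟨fun i => decide (dyadicIdx (I.k - 1) (z i) % 2 = 1), eq_of_k_m rfl (funext fun i => ?_)⟩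
  have h1 := congrFun (congrArg DCube.m hz) i
  simp only [DCube.cubeAt, child, decide_eq_true_eq] at h1 ⊢
  have h2 := dyadicIdx_succ (I.k - 1) (z i)
  rw [sub_add_cancel, h1] at h2
  split_ifs <;> omega

lemma set_eq_iUnion_child (I : DCube d) : I.set = ⋃ δ, (I.child δ).set := by
  ext z
  simp only [Set.mem_iUnion]
  constructor
  · intro hz
    obtain ⟨δ, h⟩ := exists_cubeAt_eq_child hz
    exact ⟨δ, mem_set_iff.2 h⟩
  · rintro ⟨δ, h⟩
    exact child_set_subset I δ h

lemma lintegral_eq_sum_child (I : DCube d) (g : (Fin d → ℝ) → ℝ≥0∞) :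
    ∫⁻ x in I.set, g x = ∑ δ, ∫⁻ x in (I.child δ).set, g x := by
  rw [I.set_eq_iUnion_child, lintegral_iUnion (fun δ => measurableSet_set _), tsum_fintype]
  intro δ δ' hne
  refine Set.disjoint_left.2 fun z h h' => hne (I.child_injective (eq_of_mem h h' rfl))

/-- The dyadic cubes inside `I` of at most `N` generations below are finitely many. -/
lemma finite_descendants (hd : 0 < d) (N : ℕ) (I : DCube d) :
    {J : DCube d | J.set ⊆ I.set ∧ I.k - N < J.k}.Finite := by
  induction N generalizing I with
  | zero =>
    convert Set.finite_empty
    ext J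
    simp only [Set.mem_ofPred_eq, Set.mem_empty_iff_false, iff_false, not_and, Nat.cast_zero,
      sub_zero, not_lt]
    exact fun h => k_le_of_subset hd h
  | succ N ih =>
    refine ((Set.finite_singleton I).union
      (Set.finite_iUnion fun δ => ih (I.child δ))).subset ?_
    rintro J ⟨hJ, hk⟩
    rcases (k_le_of_subset hd hJ).eq_or_lt with h | h
    · exact Or.inl (eq_of_mem J.corner_mem (hJ J.corner_mem) h)
    · right
      obtain ⟨δ, hδ⟩ := exists_cubeAt_eq_child (hJ J.corner_mem)
      refine Set.mem_iUnion.2 ⟨δ, subset_of_mem J.corner_mem (mem_set_iff.2 hδ) ?_, ?_⟩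
      · simp; omega
      · simp; push_cast at hk; omega

end DCube

/-! ## Haar functions -/

/-- The sign of a one-dimensional Haar function on the dyadic interval of index `j` one scale
below. -/
def haarSign (ε : Bool) (m j : ℤ) : ℝ :=
  if j = 2 * m then 1 else if j = 2 * m + 1 then (if ε then 1 else -1) else 0

lemma mem_left_half_iff {k m : ℤ} {t : ℝ} :
    (m : ℝ) * 2 ^ k ≤ t ∧ t < (m : ℝ) * 2 ^ k + 2 ^ (k - 1) ↔ dyadicIdx (k - 1) t = 2 * m := by
  have h : (2 : ℝ) ^ k = 2 * 2 ^ (k - 1) := by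
    rw [zpow_sub_one₀ two_ne_zero]; field_simp
  rw [dyadicIdx_eq_iff, h]
  push_cast
  constructor <;> rintro ⟨h1, h2⟩ <;> constructor <;> linarith

lemma mem_right_half_iff {k m : ℤ} {t : ℝ} :
    (m : ℝ) * 2 ^ k + 2 ^ (k - 1) ≤ t ∧ t < ((m : ℝ) + 1) * 2 ^ k ↔
      dyadicIdx (k - 1) t = 2 * m + 1 := by
  have h : (2 : ℝ) ^ k = 2 * 2 ^ (k - 1) := by
    rw [zpow_sub_one₀ two_ne_zero]; field_simp
  rw [dyadicIdx_eq_iff, h]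
  push_cast
  constructor <;> rintro ⟨h1, h2⟩ <;> constructor <;> linarith

lemma haar1D_eq (ε : Bool) (k m : ℤ) (t : ℝ) :
    haar1D ε k m t = ((2 : ℝ) ^ k) ^ (-(1 / 2 : ℝ)) * haarSign ε m (dyadicIdx (k - 1) t) := by
  have h3 : ((m : ℝ) * 2 ^ k ≤ t ∧ t < ((m : ℝ) + 1) * 2 ^ k) ↔
      (dyadicIdx (k - 1) t = 2 * m ∨ dyadicIdx (k - 1) t = 2 * m + 1) := by
    rw [← dyadicIdx_eq_iff]
    have h2 := dyadicIdx_succ (k - 1) t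
    rw [sub_add_cancel] at h2
    rw [h2]
    omega
  unfold haar1D haarSign
  simp only [Set.indicator_apply, Set.mem_ofPred_eq, mem_left_half_iff, mem_right_half_iff, h3]
  cases ε
  · by_cases h1 : dyadicIdx (k - 1) t = 2 * m
    · simp [h1]
    · by_cases h2 : dyadicIdx (k - 1) t = 2 * m + 1 <;> simp [h1, h2]
  · by_cases h1 : dyadicIdx (k - 1) t = 2 * m
    · simp [h1]
    · by_cases h2 : dyadicIdx (k - 1) t = 2 * m + 1 <;> simp [h1, h2]

lemma haar1D_congr {ε : Bool} {k m : ℤ} {s t : ℝ}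
    (h : dyadicIdx (k - 1) s = dyadicIdx (k - 1) t) : haar1D ε k m s = haar1D ε k m t := by
  rw [haar1D_eq, haar1D_eq, h]

lemma dyadicIdx_eq_of_haar1D_ne_zero {ε : Bool} {k m : ℤ} {t : ℝ} (h : haar1D ε k m t ≠ 0) :
    dyadicIdx k t = m := by
  rw [haar1D_eq] at h
  have h2 := dyadicIdx_succ (k - 1) t
  rw [sub_add_cancel] at h2
  rw [h2]
  have h3 := right_ne_zero_of_mul h
  unfold haarSign at h3
  split_ifs at h3 <;> first | omega | simp at h3

lemma haarFn_congr {d : ℕ} {I : DCube d} {ε : Fin d → Bool} {y z : Fin d → ℝ}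
    (h : DCube.cubeAt (I.k - 1) y = DCube.cubeAt (I.k - 1) z) : haarFn I ε y = haarFn I ε z :=
  Finset.prod_congr rfl fun i _ => haar1D_congr (congrFun (congrArg DCube.m h) i)

lemma mem_of_haarFn_ne_zero {d : ℕ} {I : DCube d} {ε : Fin d → Bool} {z : Fin d → ℝ}
    (h : haarFn I ε z ≠ 0) : z ∈ I.set := by
  rw [DCube.mem_set_iff]
  refine DCube.eq_of_k_m rfl (funext fun i => ?_)
  exact dyadicIdx_eq_of_haar1D_ne_zero (Finset.prod_ne_zero_iff.1 h i (Finset.mem_univ i))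

lemma exists_false_of_mem_Sfin {d : ℕ} {ε : Fin d → Bool} (h : ε ∈ Sfin d) :
    ∃ i, ε i = false := by
  by_contra hcon
  push Not at hcon
  simp only [Sfin, Finset.mem_erase, Finset.mem_univ, and_true] at h
  exact h (funext fun i => by simpa using hcon i)

/-- The cancellative Haar functions have mean zero over the children of their cube. -/
lemma sum_haarFn_child {d : ℕ} (I : DCube d) {ε : Fin d → Bool} (hε : ε ∈ Sfin d) :
    ∑ δ, haarFn I ε (I.child δ).corner = 0 := by
  obtain ⟨i, hi⟩ := exists_false_of_mem_Sfin hε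
  have h1 : ∀ δ : Fin d → Bool, haarFn I ε (I.child δ).corner =
      ∏ i, ((2 : ℝ) ^ I.k) ^ (-(1 / 2 : ℝ)) *
        haarSign (ε i) (I.m i) (2 * I.m i + if δ i then 1 else 0) := by
    intro δ
    refine Finset.prod_congr rfl fun i _ => ?_
    rw [haar1D_eq]
    congr 2
    exact dyadicIdx_corner (I.k - 1) _
  simp_rw [h1]
  have h2 := (Finset.prod_univ_sum (fun _ : Fin d => (Finset.univ : Finset Bool))
    (fun i b => ((2 : ℝ) ^ I.k) ^ (-(1 / 2 : ℝ)) *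
        haarSign (ε i) (I.m i) (2 * I.m i + if b then 1 else 0)))
  rw [Fintype.piFinset_univ] at h2
  rw [← h2]
  refine Finset.prod_eq_zero (Finset.mem_univ i) ?_
  simp [haarSign, hi]

lemma integrable_haar1D (ε : Bool) (k m : ℤ) : Integrable (haar1D ε k m) := by
  have hI : ∀ a b c : ℝ, Integrable ({s : ℝ | a ≤ s ∧ s < b}.indicator (fun _ => c)) := by
    intro a b c
    exact (integrable_indicator_iff measurableSet_Ico).2
      (integrableOn_const (by simp [Real.volume_Ico]))
  unfold haar1D
  cases ε
  · exact (hI _ _ _).sub (hI _ _ _)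
  · simpa using hI _ _ _

lemma integral_haar1D_false (k m : ℤ) : ∫ t, haar1D false k m t = 0 := by
  have hI : ∀ a b c : ℝ, Integrable ((Set.Ico a b).indicator (fun _ => c)) := by
    intro a b c
    exact (integrable_indicator_iff measurableSet_Ico).2
      (integrableOn_const (by simp [Real.volume_Ico]))
  have h1 : haar1D false k m = fun t =>
      (Set.Ico ((m : ℝ) * 2 ^ k) ((m : ℝ) * 2 ^ k + 2 ^ (k - 1))).indicator
        (fun _ => ((2 : ℝ) ^ k) ^ (-(1 / 2 : ℝ))) t -
      (Set.Ico ((m : ℝ) * 2 ^ k + 2 ^ (k - 1)) (((m : ℝ) + 1) * 2 ^ k)).indicator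
        (fun _ => ((2 : ℝ) ^ k) ^ (-(1 / 2 : ℝ))) t := by
    ext t; rfl
  rw [h1, integral_sub (hI _ _ _) (hI _ _ _), integral_indicator measurableSet_Ico,
    integral_indicator measurableSet_Ico]
  have h : (2 : ℝ) ^ k = 2 * 2 ^ (k - 1) := by
    rw [zpow_sub_one₀ two_ne_zero]; field_simp
  have h2 : ((m : ℝ) + 1) * 2 ^ k - (m * 2 ^ k + 2 ^ (k - 1)) = 2 ^ (k - 1) := by rw [h]; ring
  simp [Measure.real, Real.volume_Ico, h2]

lemma abs_haar1D_le (ε : Bool) (k m : ℤ) (t : ℝ) :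
    ‖haar1D ε k m t‖ ≤ ((2 : ℝ) ^ k) ^ (-(1 / 2 : ℝ)) := by
  have h0 : (0 : ℝ) ≤ ((2 : ℝ) ^ k) ^ (-(1 / 2 : ℝ)) := by positivity
  rw [haar1D_eq, norm_mul, Real.norm_of_nonneg h0]
  refine mul_le_of_le_one_right h0 ?_
  unfold haarSign
  split_ifs <;> simp

lemma integrable_haar1D_mul (ε ε' : Bool) (k k' m m' : ℤ) :
    Integrable fun t => haar1D ε k m t * haar1D ε' k' m' t :=
  (integrable_haar1D ε' k' m').bdd_mul (integrable_haar1D ε k m).aestronglyMeasurable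
    (Filter.Eventually.of_forall fun t => abs_haar1D_le ε k m t)

lemma integrable_haarFn_mul {d : ℕ} (I I' : DCube d) (ε ε' : Fin d → Bool) :
    Integrable fun x => haarFn I ε x * haarFn I' ε' x := by
  simp only [haarFn, ← Finset.prod_mul_distrib]
  exact Integrable.fintype_prod (f := fun i t => haar1D (ε i) I.k (I.m i) t *
    haar1D (ε' i) I'.k (I'.m i) t) fun i => integrable_haar1D_mul _ _ _ _ _ _

lemma integral_haarFn_mul_eq_prod {d : ℕ} (I I' : DCube d) (ε ε' : Fin d → Bool) :
    ∫ x, haarFn I ε x * haarFn I' ε' x =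
      ∏ i, ∫ t, haar1D (ε i) I.k (I.m i) t * haar1D (ε' i) I'.k (I'.m i) t := by
  simp only [haarFn, ← Finset.prod_mul_distrib]
  exact integral_fintype_prod_volume_eq_prod (fun i t => haar1D (ε i) I.k (I.m i) t *
    haar1D (ε' i) I'.k (I'.m i) t)

lemma integral_haar1D_mul_of_lt {ε' : Bool} {k k' m m' : ℤ} (h : k < k') :
    ∫ t, haar1D false k m t * haar1D ε' k' m' t = 0 := by
  have : (fun t => haar1D false k m t * haar1D ε' k' m' t) =
      fun t => haar1D false k m t * haar1D ε' k' m' ((m : ℝ) * 2 ^ k) := by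
    ext t
    by_cases h0 : haar1D false k m t = 0
    · rw [h0, zero_mul, zero_mul]
    · congr 1
      refine haar1D_congr (dyadicIdx_coarsen (show k ≤ k' - 1 by omega) ?_)
      rw [dyadicIdx_eq_of_haar1D_ne_zero h0, dyadicIdx_corner]
  rw [this, integral_mul_const, integral_haar1D_false, zero_mul]

lemma integral_haarFn_mul_of_lt {d : ℕ} {I I' : DCube d} {ε ε' : Fin d → Bool} (hε : ε ∈ Sfin d)
    (h : I.k < I'.k) : ∫ x, haarFn I ε x * haarFn I' ε' x = 0 := by
  obtain ⟨i, hi⟩ := exists_false_of_mem_Sfin hε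
  rw [integral_haarFn_mul_eq_prod]
  refine Finset.prod_eq_zero (Finset.mem_univ i) ?_
  rw [hi]
  exact integral_haar1D_mul_of_lt h

lemma integral_haar1D_mul_self (ε : Bool) (k m : ℤ) :
    ∫ t, haar1D ε k m t * haar1D ε k m t = 1 := by
  have h : (fun t => haar1D ε k m t * haar1D ε k m t) =
      (Set.Ico ((m : ℝ) * 2 ^ k) (((m : ℝ) + 1) * 2 ^ k)).indicator
        fun _ => ((2 : ℝ) ^ k)⁻¹ := by
    ext t
    have hc : ((2 : ℝ) ^ k) ^ (-(1 / 2 : ℝ)) * ((2 : ℝ) ^ k) ^ (-(1 / 2 : ℝ)) =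
        ((2 : ℝ) ^ k)⁻¹ := by
      rw [← Real.rpow_add (by positivity), ← Real.rpow_neg_one]
      norm_num
    by_cases ht : t ∈ Set.Ico ((m : ℝ) * 2 ^ k) (((m : ℝ) + 1) * 2 ^ k)
    · rw [Set.indicator_of_mem ht, haar1D_eq, mul_mul_mul_comm, hc]
      have h1 := dyadicIdx_eq_iff.2 ht
      have h2 := dyadicIdx_succ (k - 1) t
      rw [sub_add_cancel, h1] at h2
      have h3 : dyadicIdx (k - 1) t = 2 * m ∨ dyadicIdx (k - 1) t = 2 * m + 1 := by omega
      have h4 : haarSign ε m (dyadicIdx (k - 1) t) * haarSign ε m (dyadicIdx (k - 1) t) = 1 := by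
        rcases h3 with h3 | h3 <;> cases ε <;> simp [haarSign, h3]
      rw [h4, mul_one]
    · rw [Set.indicator_of_notMem ht]
      by_contra hne
      exact ht (dyadicIdx_eq_iff.1 (dyadicIdx_eq_of_haar1D_ne_zero (left_ne_zero_of_mul hne)))
  rw [h, integral_indicator measurableSet_Ico]
  have h2 : ((m : ℝ) + 1) * 2 ^ k - m * 2 ^ k = 2 ^ k := by ring
  have h3 : (2 : ℝ) ^ k ≠ 0 := by positivity
  have h4 : (0 : ℝ) ≤ 2 ^ k := by positivity
  rw [setIntegral_const, Measure.real, Real.volume_Ico, h2, ENNReal.toReal_ofReal h4, smul_eq_mul,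
    mul_inv_cancel₀ h3]

lemma integral_haar1D_mul_of_ne {ε ε' : Bool} (h : ε ≠ ε') (k m : ℤ) :
    ∫ t, haar1D ε k m t * haar1D ε' k m t = 0 := by
  have sgn : ∀ j, haarSign ε m j * haarSign ε' m j = haarSign false m j := by
    intro j
    unfold haarSign
    cases ε <;> cases ε' <;> simp at h ⊢ <;> split_ifs <;> simp_all
  have key : ∀ t, haar1D ε k m t * haar1D ε' k m t =
      ((2 : ℝ) ^ k) ^ (-(1 / 2 : ℝ)) * haar1D false k m t := by
    intro t
    rw [haar1D_eq, haar1D_eq, haar1D_eq, mul_mul_mul_comm, sgn, mul_assoc]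
  simp_rw [key]
  rw [integral_const_mul, integral_haar1D_false, mul_zero]

lemma integral_haarFn_mul {d : ℕ} (I I' : DCube d) {ε ε' : Fin d → Bool} (hε : ε ∈ Sfin d)
    (hε' : ε' ∈ Sfin d) [Decidable (I = I' ∧ ε = ε')] :
    ∫ x, haarFn I ε x * haarFn I' ε' x = if I = I' ∧ ε = ε' then 1 else 0 := by
  rcases lt_trichotomy I.k I'.k with h | h | h
  · rw [integral_haarFn_mul_of_lt hε h, if_neg]
    rintro ⟨rfl, -⟩; exact lt_irrefl _ h
  · split_ifs with heq
    · obtain ⟨rfl, rfl⟩ := heq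
      rw [integral_haarFn_mul_eq_prod]
      exact Finset.prod_eq_one fun i _ => integral_haar1D_mul_self _ _ _
    · by_cases hII : I = I'
      · subst hII
        obtain ⟨i, hi⟩ := Function.ne_iff.1 (fun h => heq ⟨rfl, h⟩)
        rw [integral_haarFn_mul_eq_prod]
        exact Finset.prod_eq_zero (Finset.mem_univ i) (integral_haar1D_mul_of_ne hi _ _)
      · have : (fun x => haarFn I ε x * haarFn I' ε' x) = fun _ => 0 := by
          ext x
          by_contra hne
          exact hII (DCube.eq_of_mem (mem_of_haarFn_ne_zero (left_ne_zero_of_mul hne))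
            (mem_of_haarFn_ne_zero (right_ne_zero_of_mul hne)) h)
        rw [this, integral_zero]
  · simp_rw [mul_comm (haarFn I ε _)]
    rw [integral_haarFn_mul_of_lt hε' h, if_neg]
    rintro ⟨rfl, -⟩; exact lt_irrefl _ h

/-! ## Finite Haar sums -/

section HaarSums

variable {d n : ℕ}

/-- The part `∑_{ε ∈ 𝒮} h_I^ε(z) c_I^ε` of a Haar expansion attached to one cube. -/
def haarTerm (c : DCube d → (Fin d → Bool) → EuclideanSpace ℂ (Fin n)) (I : DCube d)
    (z : Fin d → ℝ) : EuclideanSpace ℂ (Fin n) :=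
  ∑ ε ∈ Sfin d, haarFn I ε z • c I ε

lemma haarTerm_congr {c : DCube d → (Fin d → Bool) → EuclideanSpace ℂ (Fin n)} {I : DCube d}
    {y z : Fin d → ℝ} (h : DCube.cubeAt (I.k - 1) y = DCube.cubeAt (I.k - 1) z) :
    haarTerm c I y = haarTerm c I z :=
  Finset.sum_congr rfl fun ε _ => by rw [haarFn_congr h]

lemma mem_of_haarTerm_ne_zero {c : DCube d → (Fin d → Bool) → EuclideanSpace ℂ (Fin n)}
    {I : DCube d} {z : Fin d → ℝ} (h : haarTerm c I z ≠ 0) : z ∈ I.set := by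
  obtain ⟨ε, -, hε⟩ := Finset.exists_ne_zero_of_sum_ne_zero h
  exact mem_of_haarFn_ne_zero (left_ne_zero_of_smul hε)

lemma sum_haarTerm_child (c : DCube d → (Fin d → Bool) → EuclideanSpace ℂ (Fin n))
    (I : DCube d) : ∑ δ, haarTerm c I (I.child δ).corner = 0 := by
  unfold haarTerm
  rw [Finset.sum_comm]
  refine Finset.sum_eq_zero fun ε hε => ?_
  rw [← Finset.sum_smul, sum_haarFn_child I hε, zero_smul]

open Classical in
/-- A Haar sum without small cubes is, at each point, a finite sum over scales. -/
lemma tsum_haarTerm {c : DCube d → (Fin d → Bool) → EuclideanSpace ℂ (Fin n)}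
    {S : Set (DCube d)} {k₀ K : ℤ} {z : Fin d → ℝ} (hK : ∀ I ∈ S, z ∈ I.set → I.k ≤ K)
    (hc : ∀ I : DCube d, I.k ≤ k₀ → ∀ ε ∈ Sfin d, c I ε = 0) :
    ∑' I : S, haarTerm c (I : DCube d) z =
      ∑ k ∈ Finset.Ioc k₀ K,
        if DCube.cubeAt k z ∈ S then haarTerm c (DCube.cubeAt k z) z else 0 := by
  rw [tsum_subtype S (fun I => haarTerm c I z),
    tsum_eq_sum (s := (Finset.Ioc k₀ K).image fun k => DCube.cubeAt k z)]
  · rw [Finset.sum_image]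
    · rfl
    · intro k _ l _ h
      exact congrArg DCube.k h
  · intro I hI
    by_contra hne
    have hIS : I ∈ S := Set.mem_of_indicator_ne_zero hne
    rw [Set.indicator_of_mem hIS] at hne
    have hz := mem_of_haarTerm_ne_zero hne
    refine hI (Finset.mem_image.2 ⟨I.k, Finset.mem_Ioc.2 ⟨?_, hK I hIS hz⟩,
      DCube.mem_set_iff.1 hz⟩)
    by_contra hlt
    exact hne (Finset.sum_eq_zero fun ε hε => by rw [hc I (not_lt.1 hlt) ε hε, smul_zero])

lemma haarCoef_sum (G : Finset (DCube d × (Fin d → Bool)))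
    (c : DCube d × (Fin d → Bool) → EuclideanSpace ℂ (Fin n)) (I : DCube d) (ε : Fin d → Bool) :
    haarCoef (fun x => ∑ q ∈ G, haarFn q.1 q.2 x • c q) I ε =
      ∑ q ∈ G, (∫ x, haarFn I ε x * haarFn q.1 q.2 x) • c q := by
  unfold haarCoef
  simp_rw [Finset.smul_sum, smul_smul]
  rw [integral_finsetSum]
  · exact Finset.sum_congr rfl fun q _ => integral_smul_const _ _
  · exact fun q _ => (integrable_haarFn_mul _ _ _ _).smul_const _

lemma FiniteHaar.exists_scale {f : (Fin d → ℝ) → EuclideanSpace ℂ (Fin n)} (hf : FiniteHaar f) :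
    ∃ k₀ : ℤ, ∀ I : DCube d, I.k ≤ k₀ → ∀ ε ∈ Sfin d, haarCoef f I ε = 0 := by
  obtain ⟨F, hF⟩ := hf
  obtain ⟨M, hM⟩ := (F.image fun q => -q.1.k).exists_le
  refine ⟨-M - 1, fun I hI ε hε => ?_⟩
  have hf' : f = fun x => ∑ q ∈ F, haarFn q.1 q.2 x • haarCoef f q.1 q.2 := funext hF
  rw [hf', haarCoef_sum F (fun q => haarCoef f q.1 q.2)]
  refine Finset.sum_eq_zero fun q hq => ?_
  have : -q.1.k ≤ M := hM _ (Finset.mem_image_of_mem _ hq)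
  rw [integral_haarFn_mul_of_lt hε (by omega), zero_smul]

open Classical in
lemma haarCoef_tsum (hd : 0 < d) {c : DCube d → (Fin d → Bool) → EuclideanSpace ℂ (Fin n)}
    {S : Set (DCube d)} {I₀ : DCube d} {k₀ : ℤ} (hS : ∀ I ∈ S, I.set ⊆ I₀.set)
    (hc : ∀ I : DCube d, I.k ≤ k₀ → ∀ ε ∈ Sfin d, c I ε = 0) (I : DCube d)
    {ε : Fin d → Bool} (hε : ε ∈ Sfin d) :
    haarCoef (fun x => ∑' I : S, haarTerm c (I : DCube d) x) I ε =
      if I ∈ S then c I ε else 0 := by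
  set G := (DCube.finite_descendants hd (I₀.k - k₀).toNat I₀).toFinset.filter (· ∈ S) with hG
  have hG' : ∀ J ∈ S, J ∉ G → ∀ ε ∈ Sfin d, c J ε = 0 := by
    intro J hJ hJG
    refine hc J ?_
    by_contra hlt
    refine hJG ?_
    simp only [hG, Finset.mem_filter, Set.Finite.mem_toFinset, Set.mem_ofPred_eq]
    refine ⟨⟨hS J hJ, ?_⟩, hJ⟩
    have := DCube.k_le_of_subset hd (hS J hJ)
    omega
  have h1 : (fun x => ∑' I : S, haarTerm c (I : DCube d) x) =
      fun x => ∑ q ∈ G ×ˢ Sfin d, haarFn q.1 q.2 x • c q.1 q.2 := by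
    ext1 x
    rw [tsum_subtype S (fun I => haarTerm c I x), tsum_eq_sum (s := G), Finset.sum_product]
    · refine Finset.sum_congr rfl fun J hJ => ?_
      rw [Set.indicator_of_mem (Finset.mem_filter.1 hJ).2]
      rfl
    · intro J hJ
      by_cases hJS : J ∈ S
      · rw [Set.indicator_of_mem hJS]
        exact Finset.sum_eq_zero fun ε hε => by rw [hG' J hJS hJ ε hε, smul_zero]
      · exact Set.indicator_of_notMem hJS _
  rw [h1, haarCoef_sum _ (fun q => c q.1 q.2)]
  have h2 : ∀ q ∈ G ×ˢ Sfin d, (∫ x, haarFn I ε x * haarFn q.1 q.2 x) • c q.1 q.2 =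
      if q = (I, ε) then c I ε else 0 := by
    intro q hq
    rw [integral_haarFn_mul I q.1 hε (Finset.mem_product.1 hq).2]
    by_cases h : q = (I, ε)
    · subst h; simp
    · rw [if_neg, zero_smul, if_neg h]
      rintro ⟨rfl, rfl⟩; exact h rfl
  rw [Finset.sum_congr rfl h2, Finset.sum_ite_eq']
  by_cases hI : I ∈ S
  · rw [if_pos hI]
    split_ifs with h
    · rfl
    · exact (hG' I hI (fun h' => h (Finset.mem_product.2 ⟨h', hε⟩)) ε hε).symm
  · rw [if_neg hI, if_neg]
    exact fun h => hI (Finset.mem_filter.1 (Finset.mem_product.1 h).1).2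

end HaarSums

/-! ## Averages over dyadic descendants -/

section TreeSum

variable {d : ℕ}

/-- The sum of the values of `g` at the corners of all descendants of `Q`, `N` generations
below. -/
def treeSum : ℕ → DCube d → ((Fin d → ℝ) → ℝ) → ℝ
  | 0, Q, g => g Q.corner
  | N + 1, Q, g => ∑ δ, treeSum N (Q.child δ) g

lemma treeSum_mono {N : ℕ} {Q : DCube d} {g g' : (Fin d → ℝ) → ℝ}
    (h : ∀ z ∈ Q.set, g z ≤ g' z) : treeSum N Q g ≤ treeSum N Q g' := by
  induction N generalizing Q with
  | zero => exact h _ Q.corner_mem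
  | succ N ih =>
    exact Finset.sum_le_sum fun δ _ => ih fun z hz => h z (Q.child_set_subset δ hz)

lemma treeSum_add (N : ℕ) (Q : DCube d) (g g' : (Fin d → ℝ) → ℝ) :
    treeSum N Q (fun z => g z + g' z) = treeSum N Q g + treeSum N Q g' := by
  induction N generalizing Q with
  | zero => rfl
  | succ N ih => simp only [treeSum, ih, Finset.sum_add_distrib]

lemma treeSum_const_mul (N : ℕ) (Q : DCube d) (a : ℝ) (g : (Fin d → ℝ) → ℝ) :
    treeSum N Q (fun z => a * g z) = a * treeSum N Q g := by
  induction N generalizing Q with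
  | zero => rfl
  | succ N ih => simp only [treeSum, ih, Finset.mul_sum]

lemma treeSum_nonneg {N : ℕ} {Q : DCube d} {g : (Fin d → ℝ) → ℝ}
    (h : ∀ z, 0 ≤ g z) : 0 ≤ treeSum N Q g := by
  induction N generalizing Q with
  | zero => exact h _
  | succ N ih => exact Finset.sum_nonneg fun δ _ => ih

lemma lintegral_eq_treeSum {N : ℕ} {Q : DCube d} {g : (Fin d → ℝ) → ℝ} (h0 : ∀ z, 0 ≤ g z)
    (hg : ∀ y ∈ Q.set, ∀ z ∈ Q.set,
      DCube.cubeAt (Q.k - N) y = DCube.cubeAt (Q.k - N) z → g y = g z) :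
    ∫⁻ x in Q.set, ENNReal.ofReal (g x) =
      ENNReal.ofReal (treeSum N Q g) * ENNReal.ofReal (((2 : ℝ) ^ (Q.k - N)) ^ d) := by
  induction N generalizing Q with
  | zero =>
    simp only [Nat.cast_zero, sub_zero] at hg ⊢
    rw [setLIntegral_congr_fun (g := fun _ => ENNReal.ofReal (g Q.corner)) Q.measurableSet_set,
      setLIntegral_const, Q.volume_set]
    · rfl
    · intro x hx
      simp only
      rw [hg x hx _ Q.corner_mem
        ((DCube.mem_set_iff.1 hx).trans (DCube.mem_set_iff.1 Q.corner_mem).symm)]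
  | succ N ih =>
    rw [Q.lintegral_eq_sum_child, treeSum, ENNReal.ofReal_sum_of_nonneg
      (fun δ _ => treeSum_nonneg h0), Finset.sum_mul]
    refine Finset.sum_congr rfl fun δ _ => ?_
    have e : (Q.child δ).k - N = Q.k - (N + 1 : ℕ) := by rw [DCube.child_k]; push_cast; ring
    rw [← e]
    refine ih fun y hy z hz h => hg y (Q.child_set_subset δ hy) z (Q.child_set_subset δ hz) ?_
    rw [← e]; exact h

/-- Iterating the step inequality of a Burkholder function down a dyadic tree. -/
lemma treeSum_bellman_le {H : Type*} [NormedAddCommGroup H] {U : H → H → ℝ}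
    (hU : ∀ (x y : H) (h k : (Fin d → Bool) → H), ∑ i, h i = 0 → ∑ i, k i = 0 →
        (∀ i, ‖k i‖ ≤ ‖h i‖) → ∑ i, U (x + h i) (y + k i) ≤
          Fintype.card (Fin d → Bool) * U x y)
    {D E : ℤ → (Fin d → ℝ) → H}
    (hD : ∀ k y z, DCube.cubeAt (k - 1) y = DCube.cubeAt (k - 1) z → D k y = D k z)
    (hE : ∀ k y z, DCube.cubeAt (k - 1) y = DCube.cubeAt (k - 1) z → E k y = E k z)
    (hD0 : ∀ Q : DCube d, ∑ δ, D Q.k (Q.child δ).corner = 0)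
    (hE0 : ∀ Q : DCube d, ∑ δ, E Q.k (Q.child δ).corner = 0)
    (hED : ∀ k z, ‖E k z‖ ≤ ‖D k z‖) (N : ℕ) (Q : DCube d) (x y : H) :
    treeSum N Q (fun z => U (x + ∑ k ∈ Finset.Ioc (Q.k - N) Q.k, D k z)
      (y + ∑ k ∈ Finset.Ioc (Q.k - N) Q.k, E k z)) ≤
        (Fintype.card (Fin d → Bool) : ℝ) ^ N * U x y := by
  induction N generalizing Q x y with
  | zero => simp [treeSum]
  | succ N ih =>
    have hIoc : Finset.Ioc (Q.k - (N + 1 : ℕ)) Q.k =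
        insert Q.k (Finset.Ioc (Q.k - 1 - N) (Q.k - 1)) := by
      ext k; simp only [Finset.mem_Ioc, Finset.mem_insert]; push_cast; omega
    have hnot : Q.k ∉ Finset.Ioc (Q.k - 1 - N) (Q.k - 1) := by simp
    have step : ∀ δ, treeSum N (Q.child δ)
        (fun z => U (x + ∑ k ∈ Finset.Ioc (Q.k - (N + 1 : ℕ)) Q.k, D k z)
          (y + ∑ k ∈ Finset.Ioc (Q.k - (N + 1 : ℕ)) Q.k, E k z)) ≤
        (Fintype.card (Fin d → Bool) : ℝ) ^ N *
          U (x + D Q.k (Q.child δ).corner) (y + E Q.k (Q.child δ).corner) := by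
      intro δ
      refine le_trans (treeSum_mono fun z hz => le_of_eq ?_) (ih (Q.child δ) _ _)
      have hz' : DCube.cubeAt (Q.k - 1) z = DCube.cubeAt (Q.k - 1) (Q.child δ).corner :=
        (DCube.mem_set_iff.1 hz).trans (DCube.mem_set_iff.1 (Q.child δ).corner_mem).symm
      rw [hIoc, Finset.sum_insert hnot, Finset.sum_insert hnot, ← add_assoc, ← add_assoc,
        hD _ _ _ hz', hE _ _ _ hz', DCube.child_k]
    calc _ ≤ ∑ δ, (Fintype.card (Fin d → Bool) : ℝ) ^ N *
          U (x + D Q.k (Q.child δ).corner) (y + E Q.k (Q.child δ).corner) :=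
          Finset.sum_le_sum fun δ _ => step δ
      _ ≤ (Fintype.card (Fin d → Bool) : ℝ) ^ N * (Fintype.card (Fin d → Bool) * U x y) := by
          rw [← Finset.mul_sum]
          exact mul_le_mul_of_nonneg_left (hU x y _ _ (hD0 Q) (hE0 Q) fun δ => hED _ _)
            (by positivity)
      _ = _ := by ring

/-- `L^p` boundedness of dyadic martingale transforms. -/
lemma exists_martingale_transform_bound (H : Type*) [NormedAddCommGroup H] [InnerProductSpace ℝ H]
    {p : ℝ} (hp : 1 < p) : ∃ C : ℝ, 0 < C ∧ ∀ {d : ℕ} (D E : ℤ → (Fin d → ℝ) → H),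
    (∀ k y z, DCube.cubeAt (k - 1) y = DCube.cubeAt (k - 1) z → D k y = D k z) →
    (∀ k y z, DCube.cubeAt (k - 1) y = DCube.cubeAt (k - 1) z → E k y = E k z) →
    (∀ Q : DCube d, ∑ δ, D Q.k (Q.child δ).corner = 0) →
    (∀ Q : DCube d, ∑ δ, E Q.k (Q.child δ).corner = 0) →
    (∀ k z, ‖E k z‖ ≤ ‖D k z‖) → ∀ (k₀ : ℤ) (Q : DCube d),
    ∫⁻ z in Q.set, ENNReal.ofReal ‖∑ k ∈ Finset.Ioc k₀ Q.k, E k z‖ ^ p ≤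
      ENNReal.ofReal C * ∫⁻ z in Q.set, ENNReal.ofReal ‖∑ k ∈ Finset.Ioc k₀ Q.k, D k z‖ ^ p := by
  obtain ⟨C, hC, hU⟩ := exists_bellman (H := H) hp
  refine ⟨C, hC, fun {d} D E hD hE hD0 hE0 hED k₀ Q => ?_⟩
  have hp0 : 0 ≤ p := by linarith
  set N := (Q.k - k₀).toNat with hN
  have hIoc : Finset.Ioc k₀ Q.k = Finset.Ioc (Q.k - N) Q.k := by
    ext k; simp only [Finset.mem_Ioc, hN]; omega
  have hconst : ∀ F : ℤ → (Fin d → ℝ) → H,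
      (∀ k y z, DCube.cubeAt (k - 1) y = DCube.cubeAt (k - 1) z → F k y = F k z) →
      ∫⁻ z in Q.set, ENNReal.ofReal ‖∑ k ∈ Finset.Ioc k₀ Q.k, F k z‖ ^ p =
        ENNReal.ofReal (treeSum N Q fun z => ‖∑ k ∈ Finset.Ioc (Q.k - N) Q.k, F k z‖ ^ p) *
          ENNReal.ofReal (((2 : ℝ) ^ (Q.k - N)) ^ d) := by
    intro F hF
    simp_rw [hIoc, ENNReal.ofReal_rpow_of_nonneg (norm_nonneg _) hp0]
    refine lintegral_eq_treeSum (fun z => by positivity) fun y _ z _ h => ?_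
    congr 2
    refine Finset.sum_congr rfl fun k hk => hF k y z (DCube.cubeAt_coarsen ?_ h)
    have := (Finset.mem_Ioc.1 hk).1
    omega
  rw [hconst E hE, hconst D hD, ← mul_assoc, ← ENNReal.ofReal_mul hC.le]
  refine mul_le_mul_left (ENNReal.ofReal_le_ofReal ?_) _
  refine le_of_forall_pos_le_add fun η hη => ?_
  set M := treeSum N Q (fun _ => (1 : ℝ)) with hM
  have hM0 : 0 ≤ M := treeSum_nonneg fun _ => zero_le_one
  obtain ⟨U, hU0, hUl, hUs⟩ := hU (η / (C * (M + 1))) (by positivity)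
  have h1 := treeSum_bellman_le (hUs (Fin d → Bool)) hD hE hD0 hE0 hED N Q 0 0
  simp only [zero_add] at h1
  have h2 : treeSum N Q (fun z => ‖∑ k ∈ Finset.Ioc (Q.k - N) Q.k, E k z‖ ^ p) ≤
      treeSum N Q (fun z => U (∑ k ∈ Finset.Ioc (Q.k - N) Q.k, D k z)
        (∑ k ∈ Finset.Ioc (Q.k - N) Q.k, E k z) +
        (C * (η / (C * (M + 1))) * 1 + C * ‖∑ k ∈ Finset.Ioc (Q.k - N) Q.k, D k z‖ ^ p)) := by
    refine treeSum_mono fun z _ => (hUl (∑ k ∈ Finset.Ioc (Q.k - N) Q.k, D k z) _).trans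
      (le_of_eq ?_)
    ring
  rw [treeSum_add, treeSum_add, treeSum_const_mul, treeSum_const_mul] at h2
  have h3 : (Fintype.card (Fin d → Bool) : ℝ) ^ N * U 0 0 ≤ 0 :=
    mul_nonpos_of_nonneg_of_nonpos (by positivity) hU0
  have h4 : C * (η / (C * (M + 1))) * M ≤ η := by
    have : C * (η / (C * (M + 1))) * M = η * (M / (M + 1)) := by field_simp
    rw [this]
    exact mul_le_of_le_one_right hη.le (by rw [div_le_one (by positivity)]; linarith)
  linarith

end TreeSum

/-! ## Structure of stopping times -/

section Stopping

variable {d n : ℕ}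

lemma isStopping_stopST (p l₁ l₂ : ℝ) (V : DCube d → Matrix (Fin n) (Fin n) ℂ) :
    IsStopping (stopST p l₁ l₂ V) := by
  refine fun I => ⟨fun J hJ => hJ.1, fun J hJ K hK hne => Set.disjoint_left.2 fun z hzJ hzK => ?_⟩
  rcases le_total J.k K.k with h | h
  · exact hne (hJ.2.2 K hK.1 hK.2.1 (DCube.subset_of_mem hzJ hzK h)).symm
  · exact hne (hK.2.2 J hJ.1 hJ.2.1 (DCube.subset_of_mem hzK hzJ h))

lemma not_stopBad_of_mem_Fcol (hd : 0 < d) {p l₁ l₂ : ℝ}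
    {V : DCube d → Matrix (Fin n) (Fin n) ℂ} {I J : DCube d}
    (hI : I ∈ Fcol (stopST p l₁ l₂ V) J) : ¬stopBad p l₁ l₂ V I J := by
  intro hbad
  obtain ⟨k, ⟨K, hKJ, hK, hIK, rfl⟩, hmax⟩ := Int.exists_greatest_of_bdd
    (P := fun k => ∃ K : DCube d, K.set ⊆ J.set ∧ stopBad p l₁ l₂ V K J ∧ I.set ⊆ K.set ∧ K.k = k)
    ⟨J.k, fun k ⟨K, hKJ, _, _, hk⟩ => hk ▸ DCube.k_le_of_subset hd hKJ⟩
    ⟨I.k, I, hI.1, hbad, subset_rfl, rfl⟩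
  refine hI.2 K ⟨hKJ, hK, fun K' hK'J hK' hKK' => ?_⟩ hIK
  exact DCube.eq_of_mem (hKK' K.corner_mem) K.corner_mem
    (le_antisymm (hmax _ ⟨K', hK'J, hK', hIK.trans hKK', rfl⟩) (DCube.k_le_of_subset hd hKK'))

variable {𝒥 : DCube d → Set (DCube d)} {I J K Q I₀ : DCube d} {z : Fin d → ℝ} {j : ℕ}

lemma child_mem_Fcol_or_mem (hd : 0 < d) (hQ : Q ∈ Fcol 𝒥 J) (δ : Fin d → Bool) :
    Q.child δ ∈ Fcol 𝒥 J ∨ Q.child δ ∈ 𝒥 J := by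
  by_contra! hcon
  obtain ⟨h1, h2⟩ := hcon
  refine h1 ⟨(Q.child_set_subset δ).trans hQ.1, fun K hK hLK => h2 ?_⟩
  have hc := (Q.child δ).corner_mem
  have hk := DCube.k_le_of_subset hd hLK
  have hlt : ¬Q.k ≤ K.k := fun hle =>
    hQ.2 K hK (DCube.subset_of_mem (Q.child_set_subset δ hc) (hLK hc) hle)
  rw [DCube.child_k] at hk
  rwa [DCube.eq_of_mem hc (hLK hc) (by rw [DCube.child_k]; omega)]

lemma self_mem_Fcol (hI : I ∈ Fcol 𝒥 J) : J ∈ Fcol 𝒥 J :=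
  ⟨subset_rfl, fun K hK h => hI.2 K hK (hI.1.trans h)⟩

lemma IsStopping.subset_of_mem_JIter (h : IsStopping 𝒥) (hJ : J ∈ JIter 𝒥 j I₀) :
    J.set ⊆ I₀.set := by
  induction j generalizing J with
  | zero => rw [Set.mem_singleton_iff.1 hJ]
  | succ j ih =>
    obtain ⟨K, hK, hJK⟩ := Set.mem_iUnion₂.1 hJ
    exact ((h K).1 J hJK).trans (ih hK)

lemma IsStopping.eq_of_mem_JIter (h : IsStopping 𝒥) (hJ : J ∈ JIter 𝒥 j I₀)
    (hK : K ∈ JIter 𝒥 j I₀) (hzJ : z ∈ J.set) (hzK : z ∈ K.set) : J = K := by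
  induction j generalizing J K with
  | zero => rw [Set.mem_singleton_iff.1 hJ, Set.mem_singleton_iff.1 hK]
  | succ j ih =>
    obtain ⟨J', hJ', hJJ'⟩ := Set.mem_iUnion₂.1 hJ
    obtain ⟨K', hK', hKK'⟩ := Set.mem_iUnion₂.1 hK
    obtain rfl := ih hJ' hK' ((h J').1 J hJJ' hzJ) ((h K').1 K hKK' hzK)
    by_contra hne
    exact Set.disjoint_left.1 ((h J').2 hJJ' hKK' hne) hzJ hzK

lemma IsStopping.mem_Fj_iff (h : IsStopping 𝒥) (hJ : J ∈ JIter 𝒥 (j - 1) I₀) (hzJ : z ∈ J.set)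
    (hzI : z ∈ I.set) : I ∈ Fj 𝒥 I₀ j ↔ I ∈ Fcol 𝒥 J := by
  refine ⟨fun hI => ?_, fun hI => Set.mem_iUnion₂.2 ⟨J, hJ, hI⟩⟩
  obtain ⟨K, hK, hIK⟩ := Set.mem_iUnion₂.1 hI
  rwa [h.eq_of_mem_JIter hJ hK hzJ (hIK.1 hzI)]

lemma IsStopping.subset_of_mem_Fj (h : IsStopping 𝒥) (hI : I ∈ Fj 𝒥 I₀ j) :
    I.set ⊆ I₀.set := by
  obtain ⟨K, hK, hIK⟩ := Set.mem_iUnion₂.1 hI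
  exact hIK.1.trans (h.subset_of_mem_JIter hK)

end Stopping

/-! ## Reducing operators -/

section Reducing

variable {d n : ℕ}

lemma mApp_mul (A B : Matrix (Fin n) (Fin n) ℂ) (v : EuclideanSpace ℂ (Fin n)) :
    mApp (A * B) v = mApp A (mApp B v) := by
  simp [mApp, map_mul]

lemma norm_mApp_le (A : Matrix (Fin n) (Fin n) ℂ) (v : EuclideanSpace ℂ (Fin n)) :
    ‖mApp A v‖ ≤ matNorm A * ‖v‖ :=
  ContinuousLinearMap.le_opNorm _ _

lemma matNorm_nonneg (A : Matrix (Fin n) (Fin n) ℂ) : 0 ≤ matNorm A := norm_nonneg _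

lemma matNorm_conjTranspose (A : Matrix (Fin n) (Fin n) ℂ) :
    matNorm A.conjTranspose = matNorm A := by
  unfold matNorm
  rw [← Matrix.star_eq_conjTranspose, map_star, ContinuousLinearMap.star_eq_adjoint]
  exact LinearIsometryEquiv.norm_map _ _

@[simp] lemma mApp_zero (A : Matrix (Fin n) (Fin n) ℂ) :
    mApp A (0 : EuclideanSpace ℂ (Fin n)) = 0 := map_zero _

lemma mApp_sum {ι : Type*} (A : Matrix (Fin n) (Fin n) ℂ) (s : Finset ι)
    (g : ι → EuclideanSpace ℂ (Fin n)) : mApp A (∑ i ∈ s, g i) = ∑ i ∈ s, mApp A (g i) :=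
  map_sum _ _ _

lemma mApp_haarTerm (A : Matrix (Fin n) (Fin n) ℂ)
    (c : DCube d → (Fin d → Bool) → EuclideanSpace ℂ (Fin n)) (I : DCube d) (z : Fin d → ℝ) :
    mApp A (haarTerm c I z) = haarTerm (fun I ε => mApp A (c I ε)) I z := by
  unfold haarTerm
  rw [mApp_sum]
  exact Finset.sum_congr rfl fun ε _ => ContinuousLinearMap.map_smul_of_tower _ _ _

lemma matNorm_mul_inv_comm {A B : Matrix (Fin n) (Fin n) ℂ} (hA : A.PosDef) (hB : B.PosDef) :
    matNorm (A * B⁻¹) = matNorm (B⁻¹ * A) := by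
  rw [← matNorm_conjTranspose, Matrix.conjTranspose_mul, hA.isHermitian.eq,
    hB.isHermitian.inv.eq]

lemma mApp_eq_mApp_mul_inv {A B : Matrix (Fin n) (Fin n) ℂ} (hB : B.PosDef)
    (v : EuclideanSpace ℂ (Fin n)) : mApp A v = mApp (A * B⁻¹) (mApp B v) := by
  rw [← mApp_mul, Matrix.mul_assoc, Matrix.nonsing_inv_mul B (hB.isUnit.map Matrix.detMonoidHom),
    Matrix.mul_one]

lemma IsReducing.lintegral_le {p c₁ c₂ : ℝ} (hp : 0 < p) (hc₁ : 0 < c₁)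
    {W1p : (Fin d → ℝ) → Matrix (Fin n) (Fin n) ℂ} {V : DCube d → Matrix (Fin n) (Fin n) ℂ}
    (hV : IsReducing p c₁ c₂ W1p V) (Q : DCube d) (v : EuclideanSpace ℂ (Fin n)) :
    ∫⁻ x in Q.set, ENNReal.ofReal ‖mApp (W1p x) v‖ ^ p ≤
      ENNReal.ofReal (c₁⁻¹ ^ p * Q.vol * ‖mApp (V Q) v‖ ^ p) := by
  have h := ENNReal.rpow_le_rpow ((hV Q).2 v).1 hp.le
  rw [redAvgD, ENNReal.mul_rpow_of_nonneg _ _ hp.le, ← ENNReal.rpow_mul, one_div,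
    inv_mul_cancel₀ hp.ne', ENNReal.rpow_one, ENNReal.ofReal_rpow_of_pos hc₁,
    ENNReal.ofReal_rpow_of_nonneg (norm_nonneg _) hp.le,
    ← ENNReal.ofReal_inv_of_pos Q.vol_pos, ← mul_assoc,
    ← ENNReal.ofReal_mul (by positivity)] at h
  have hpos : 0 < c₁ ^ p * Q.vol⁻¹ := mul_pos (by positivity) (inv_pos.2 Q.vol_pos)
  rw [mul_comm, ← ENNReal.le_div_iff_mul_le (Or.inl (ENNReal.ofReal_pos.2 hpos).ne')
    (Or.inl ENNReal.ofReal_ne_top), ← ENNReal.ofReal_div_of_pos hpos] at h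
  refine h.trans_eq (congrArg _ ?_)
  have := Q.vol_pos
  rw [Real.inv_rpow hc₁.le]
  field_simp

/-- On a subcube comparable to a cube before stopping, the weight is dominated by the reducing
operator of the top cube. -/
lemma IsReducing.lintegral_le_of_not_stopBad {p c₁ c₂ l₁ l₂ : ℝ} (hp : 0 < p) (hc₁ : 0 < c₁)
    {W1p : (Fin d → ℝ) → Matrix (Fin n) (Fin n) ℂ} {V : DCube d → Matrix (Fin n) (Fin n) ℂ}
    (hV : IsReducing p c₁ c₂ W1p V) {J Q L : DCube d} (hl₁ : 0 ≤ l₁)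
    (hQ : ¬stopBad p l₁ l₂ V Q J) (hL : L.set ⊆ Q.set) (hvol : Q.vol ≤ 2 ^ d * L.vol)
    (v : EuclideanSpace ℂ (Fin n)) :
    ∫⁻ x in L.set, ENNReal.ofReal ‖mApp (W1p x) v‖ ^ p ≤
      ENNReal.ofReal (c₁⁻¹ ^ p * 2 ^ d * l₁) *
        (ENNReal.ofReal ‖mApp (V J) v‖ ^ p * volume L.set) := by
  refine (lintegral_mono_set hL).trans ((hV.lintegral_le hp hc₁ Q v).trans ?_)
  rw [ENNReal.ofReal_rpow_of_nonneg (norm_nonneg _) hp.le, L.volume_set,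
    ← ENNReal.ofReal_mul (by positivity), ← ENNReal.ofReal_mul (by positivity)]
  refine ENNReal.ofReal_le_ofReal ?_
  have h1 : ‖mApp (V Q) v‖ ^ p ≤ l₁ * ‖mApp (V J) v‖ ^ p := by
    rw [mApp_eq_mApp_mul_inv (hV J).1]
    refine (Real.rpow_le_rpow (norm_nonneg _) (norm_mApp_le _ _) hp.le).trans ?_
    rw [Real.mul_rpow (matNorm_nonneg _) (norm_nonneg _)]
    exact mul_le_mul_of_nonneg_right (not_lt.1 fun h => hQ (Or.inl h)) (by positivity)
  have := L.vol_pos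
  calc c₁⁻¹ ^ p * Q.vol * ‖mApp (V Q) v‖ ^ p
      ≤ c₁⁻¹ ^ p * (2 ^ d * L.vol) * (l₁ * ‖mApp (V J) v‖ ^ p) := by gcongr
    _ = _ := by ring

end Reducing

/-! ## Comparing the weight with a reducing operator on a stopping tree -/

section Tree

variable {d n : ℕ}

lemma lintegral_weight_le_of_const {p : ℝ} {W1p : (Fin d → ℝ) → Matrix (Fin n) (Fin n) ℂ}
    {A : Matrix (Fin n) (Fin n) ℂ} {C : ℝ≥0∞} {L : DCube d}
    {g : (Fin d → ℝ) → EuclideanSpace ℂ (Fin n)}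
    (hL : ∀ v, ∫⁻ x in L.set, ENNReal.ofReal ‖mApp (W1p x) v‖ ^ p ≤
      C * (ENNReal.ofReal ‖mApp A v‖ ^ p * volume L.set))
    (hg : ∀ y ∈ L.set, ∀ z ∈ L.set, g y = g z) :
    ∫⁻ x in L.set, ENNReal.ofReal ‖mApp (W1p x) (g x)‖ ^ p ≤
      C * ∫⁻ x in L.set, ENNReal.ofReal ‖mApp A (g x)‖ ^ p := by
  have h1 : ∀ B : (Fin d → ℝ) → Matrix (Fin n) (Fin n) ℂ,
      ∫⁻ x in L.set, ENNReal.ofReal ‖mApp (B x) (g x)‖ ^ p =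
        ∫⁻ x in L.set, ENNReal.ofReal ‖mApp (B x) (g L.corner)‖ ^ p := fun B =>
    setLIntegral_congr_fun L.measurableSet_set fun x hx => by
      simp only [hg x hx _ L.corner_mem]
  rw [h1 W1p, h1 fun _ => A, setLIntegral_const]
  exact hL _

lemma lintegral_weight_le {p : ℝ} (hd : 0 < d) {W1p : (Fin d → ℝ) → Matrix (Fin n) (Fin n) ℂ}
    {A : Matrix (Fin n) (Fin n) ℂ} {C : ℝ≥0∞} {𝒥 : DCube d → Set (DCube d)} {J : DCube d}
    {g : (Fin d → ℝ) → EuclideanSpace ℂ (Fin n)} {k₀ : ℤ}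
    (hC : ∀ Q ∈ Fcol 𝒥 J, ∀ L : DCube d, L.set ⊆ Q.set → Q.vol ≤ 2 ^ d * L.vol →
      ∀ v, ∫⁻ x in L.set, ENNReal.ofReal ‖mApp (W1p x) v‖ ^ p ≤
        C * (ENNReal.ofReal ‖mApp A v‖ ^ p * volume L.set))
    (hg : ∀ y z, DCube.cubeAt k₀ y = DCube.cubeAt k₀ z → g y = g z)
    (hgJ : ∀ L ∈ 𝒥 J, ∀ y ∈ L.set, ∀ z ∈ L.set, g y = g z) (N : ℕ) {Q : DCube d}
    (hQ : Q ∈ Fcol 𝒥 J) (hk : Q.k ≤ k₀ + N) :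
    ∫⁻ x in Q.set, ENNReal.ofReal ‖mApp (W1p x) (g x)‖ ^ p ≤
      C * ∫⁻ x in Q.set, ENNReal.ofReal ‖mApp A (g x)‖ ^ p := by
  induction N generalizing Q with
  | zero =>
    refine lintegral_weight_le_of_const (hC Q hQ Q subset_rfl ?_) fun y hy z hz => hg y z ?_
    · have h2 : (1 : ℝ) ≤ 2 ^ d := one_le_pow₀ one_le_two
      nlinarith [Q.vol_pos]
    · refine DCube.cubeAt_coarsen (k := Q.k) (by simpa using hk) ?_
      rw [DCube.mem_set_iff.1 hy, DCube.mem_set_iff.1 hz]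
  | succ N ih =>
    rw [Q.lintegral_eq_sum_child, Q.lintegral_eq_sum_child, Finset.mul_sum]
    refine Finset.sum_le_sum fun δ _ => ?_
    rcases child_mem_Fcol_or_mem hd hQ δ with h | h
    · refine ih h ?_
      rw [DCube.child_k]; push_cast at hk; omega
    · exact lintegral_weight_le_of_const
        (hC Q hQ _ (Q.child_set_subset δ) (Q.child_vol δ).le) (hgJ _ h)

open Classical in
/-- The scale-`k` part of a Haar expansion restricted to a family of cubes. -/
def scaleTerm (S : Set (DCube d)) (c : DCube d → (Fin d → Bool) → EuclideanSpace ℂ (Fin n))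
    (k : ℤ) (z : Fin d → ℝ) : EuclideanSpace ℂ (Fin n) :=
  if DCube.cubeAt k z ∈ S then haarTerm c (DCube.cubeAt k z) z else 0

lemma scaleTerm_congr {S : Set (DCube d)}
    {c : DCube d → (Fin d → Bool) → EuclideanSpace ℂ (Fin n)} {k : ℤ} {y z : Fin d → ℝ}
    (h : DCube.cubeAt (k - 1) y = DCube.cubeAt (k - 1) z) :
    scaleTerm S c k y = scaleTerm S c k z := by
  have h1 : DCube.cubeAt k y = DCube.cubeAt k z := DCube.cubeAt_coarsen (by omega) h
  unfold scaleTerm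
  rw [h1, haarTerm_congr (I := DCube.cubeAt k z) h]

lemma sum_scaleTerm_child (S : Set (DCube d))
    (c : DCube d → (Fin d → Bool) → EuclideanSpace ℂ (Fin n)) (Q : DCube d) :
    ∑ δ, scaleTerm S c Q.k (Q.child δ).corner = 0 := by
  have h : ∀ δ, DCube.cubeAt Q.k (Q.child δ).corner = Q := fun δ =>
    DCube.mem_set_iff.1 (Q.child_set_subset δ (Q.child δ).corner_mem)
  unfold scaleTerm
  by_cases hQ : Q ∈ S
  · rw [← sum_haarTerm_child c Q]
    exact Finset.sum_congr rfl fun δ _ => by rw [h, if_pos hQ]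
  · exact Finset.sum_eq_zero fun δ _ => by rw [h, if_neg hQ]

lemma scaleTerm_const_of_mem {𝒥 : DCube d → Set (DCube d)} {J L : DCube d}
    {c : DCube d → (Fin d → Bool) → EuclideanSpace ℂ (Fin n)} (hL : L ∈ 𝒥 J) {y z : Fin d → ℝ}
    (hy : y ∈ L.set) (hz : z ∈ L.set) (k : ℤ) :
    scaleTerm (Fcol 𝒥 J) c k y = scaleTerm (Fcol 𝒥 J) c k z := by
  rcases lt_or_ge L.k k with h | h
  · refine scaleTerm_congr (DCube.cubeAt_coarsen (k := L.k) (by omega) ?_)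
    rw [DCube.mem_set_iff.1 hy, DCube.mem_set_iff.1 hz]
  · have h0 : ∀ x ∈ L.set, scaleTerm (Fcol 𝒥 J) c k x = 0 := fun x hx =>
      if_neg fun hmem => hmem.2 L hL (DCube.subset_of_mem (DCube.mem_cubeAt k x) hx h)
    rw [h0 y hy, h0 z hz]

lemma norm_mApp_mApp_inv_le (hd : 0 < d) {p l₁ l₂ : ℝ} (hp : 1 < p)
    {V : DCube d → Matrix (Fin n) (Fin n) ℂ} (hV : ∀ I, (V I).PosDef) {I J : DCube d}
    (hI : I ∈ Fcol (stopST p l₁ l₂ V) J) (v : EuclideanSpace ℂ (Fin n)) :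
    ‖mApp (V J) (mApp (V I)⁻¹ v)‖ ≤ l₂ ^ ((p - 1) / p) * ‖v‖ := by
  have hp1 : 0 < p - 1 := by linarith
  have hp0 : 0 < p := by linarith
  have hm : matNorm (V J * (V I)⁻¹) ≤ l₂ ^ ((p - 1) / p) := by
    rw [matNorm_mul_inv_comm (hV J) (hV I)]
    have h2 := not_lt.1 fun h' => not_stopBad_of_mem_Fcol hd hI (Or.inr h')
    have h3 := Real.rpow_le_rpow (Real.rpow_nonneg (matNorm_nonneg _) _) h2
      (div_pos hp1 hp0).le
    rwa [← Real.rpow_mul (matNorm_nonneg _), div_mul_div_cancel₀ hp1.ne', div_self hp0.ne',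
      Real.rpow_one] at h3
  rw [← mApp_mul]
  exact (norm_mApp_le _ _).trans (mul_le_mul_of_nonneg_right hm (norm_nonneg _))

lemma norm_mApp_scaleTerm_le (hd : 0 < d) {p l₁ l₂ : ℝ} (hp : 1 < p) (hl₂ : 0 ≤ l₂)
    {V : DCube d → Matrix (Fin n) (Fin n) ℂ} (hV : ∀ I, (V I).PosDef) (J : DCube d)
    (c : DCube d → (Fin d → Bool) → EuclideanSpace ℂ (Fin n)) (k : ℤ) (z : Fin d → ℝ) :
    ‖mApp (V J) (scaleTerm (Fcol (stopST p l₁ l₂ V) J) (fun I ε => mApp (V I)⁻¹ (c I ε)) k z)‖ ≤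
      ‖l₂ ^ ((p - 1) / p) • scaleTerm (Fcol (stopST p l₁ l₂ V) J) c k z‖ := by
  rw [norm_smul, Real.norm_of_nonneg (Real.rpow_nonneg hl₂ _)]
  unfold scaleTerm
  by_cases h : DCube.cubeAt k z ∈ Fcol (stopST p l₁ l₂ V) J
  · rw [if_pos h, if_pos h]
    have e : haarTerm (fun I ε => mApp (V I)⁻¹ (c I ε)) (DCube.cubeAt k z) z =
        mApp (V (DCube.cubeAt k z))⁻¹ (haarTerm c (DCube.cubeAt k z) z) := by
      rw [mApp_haarTerm]
      rfl
    rw [e]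
    exact norm_mApp_mApp_inv_le hd hp hV h _
  · rw [if_neg h, if_neg h, mApp_zero, norm_zero, mul_zero]

end Tree

/-! ## The Haar multiplier on the pieces of a stopping time -/

section Multiplier

variable {d n : ℕ}

lemma projInv_deltaHaar (hd : 0 < d) {𝒥 : DCube d → Set (DCube d)} (h𝒥 : IsStopping 𝒥)
    (V : DCube d → Matrix (Fin n) (Fin n) ℂ) (I₀ : DCube d) (j : ℕ)
    {f : (Fin d → ℝ) → EuclideanSpace ℂ (Fin n)} (hf : FiniteHaar f) (z : Fin d → ℝ) :
    projInv V {J : DCube d | J.set ⊆ I₀.set} (deltaHaar 𝒥 I₀ j f) z =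
      ∑' I : Fj 𝒥 I₀ j, haarTerm (fun I ε => mApp (V I)⁻¹ (haarCoef f I ε)) (I : DCube d) z := by
  classical
  obtain ⟨k₀, hk₀⟩ := hf.exists_scale
  have hcoef : ∀ I : DCube d, ∀ ε ∈ Sfin d, haarCoef (deltaHaar 𝒥 I₀ j f) I ε =
      if I ∈ Fj 𝒥 I₀ j then haarCoef f I ε else 0 := fun I ε hε =>
    haarCoef_tsum hd (fun I hI => h𝒥.subset_of_mem_Fj hI) hk₀ I hε
  have hterm : ∀ I : DCube d,
      ∑ ε ∈ Sfin d, haarFn I ε z • mApp (V I)⁻¹ (haarCoef (deltaHaar 𝒥 I₀ j f) I ε) =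
        if I ∈ Fj 𝒥 I₀ j then haarTerm (fun I ε => mApp (V I)⁻¹ (haarCoef f I ε)) I z else 0 := by
    intro I
    split_ifs with hI
    · exact Finset.sum_congr rfl fun ε hε => by rw [hcoef I ε hε, if_pos hI]
    · exact Finset.sum_eq_zero fun ε hε => by rw [hcoef I ε hε, if_neg hI, mApp_zero, smul_zero]
  unfold projInv
  simp only [hterm]
  rw [tsum_subtype {J : DCube d | J.set ⊆ I₀.set} fun I => if I ∈ Fj 𝒥 I₀ j then
      haarTerm (fun I ε => mApp (V I)⁻¹ (haarCoef f I ε)) I z else 0,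
    tsum_subtype (Fj 𝒥 I₀ j) fun I => haarTerm (fun I ε => mApp (V I)⁻¹ (haarCoef f I ε)) I z]
  refine tsum_congr fun I => ?_
  by_cases hI : I ∈ Fj 𝒥 I₀ j
  · rw [Set.indicator_of_mem hI, Set.indicator_of_mem, if_pos hI]
    exact h𝒥.subset_of_mem_Fj hI
  · rw [Set.indicator_of_notMem hI, Set.indicator_apply, if_neg hI, ite_self]

lemma tsum_Fj_eq_sum_scaleTerm (hd : 0 < d) {𝒥 : DCube d → Set (DCube d)} (h𝒥 : IsStopping 𝒥)
    {I₀ J : DCube d} {j : ℕ} {k₀ : ℤ} {z : Fin d → ℝ}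
    {c : DCube d → (Fin d → Bool) → EuclideanSpace ℂ (Fin n)}
    (hc : ∀ I : DCube d, I.k ≤ k₀ → ∀ ε ∈ Sfin d, c I ε = 0)
    (hJ : J ∈ JIter 𝒥 (j - 1) I₀) (hz : z ∈ J.set) :
    ∑' I : Fj 𝒥 I₀ j, haarTerm c (I : DCube d) z =
      ∑ k ∈ Finset.Ioc k₀ J.k, scaleTerm (Fcol 𝒥 J) c k z := by
  rw [tsum_haarTerm (K := J.k) (fun I hI hzI =>
    DCube.k_le_of_subset hd ((h𝒥.mem_Fj_iff hJ hz hzI).1 hI).1) hc]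
  refine Finset.sum_congr rfl fun k _ => ?_
  unfold scaleTerm
  rw [h𝒥.mem_Fj_iff hJ hz (DCube.mem_cubeAt k z)]

lemma tsum_Fj_eq_zero {𝒥 : DCube d → Set (DCube d)} {I₀ : DCube d} {j : ℕ} {z : Fin d → ℝ}
    (c : DCube d → (Fin d → Bool) → EuclideanSpace ℂ (Fin n))
    (hz : z ∉ ⋃ J : JIter 𝒥 (j - 1) I₀, (J : DCube d).set) :
    ∑' I : Fj 𝒥 I₀ j, haarTerm c (I : DCube d) z = 0 := by
  refine (tsum_congr fun I => ?_).trans tsum_zero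
  by_contra hne
  obtain ⟨J, hJ, hIJ⟩ := Set.mem_iUnion₂.1 I.2
  exact hz (Set.mem_iUnion.2 ⟨⟨J, hJ⟩, hIJ.1 (mem_of_haarTerm_ne_zero hne)⟩)

/-- The estimate on one tree `ℱ(J)`. -/
lemma lintegral_scaleTerm_le (hd : 0 < d) {p c₁ c₂ l₁ l₂ C : ℝ} (hp : 1 < p) (hc₁ : 0 < c₁)
    (hl₁ : 0 ≤ l₁) (hl₂ : 0 ≤ l₂)
    (hC : ∀ D E : ℤ → (Fin d → ℝ) → EuclideanSpace ℂ (Fin n),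
      (∀ k y z, DCube.cubeAt (k - 1) y = DCube.cubeAt (k - 1) z → D k y = D k z) →
      (∀ k y z, DCube.cubeAt (k - 1) y = DCube.cubeAt (k - 1) z → E k y = E k z) →
      (∀ Q : DCube d, ∑ δ, D Q.k (Q.child δ).corner = 0) →
      (∀ Q : DCube d, ∑ δ, E Q.k (Q.child δ).corner = 0) →
      (∀ k z, ‖E k z‖ ≤ ‖D k z‖) → ∀ (k₀ : ℤ) (Q : DCube d),
      ∫⁻ z in Q.set, ENNReal.ofReal ‖∑ k ∈ Finset.Ioc k₀ Q.k, E k z‖ ^ p ≤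
        ENNReal.ofReal C *
          ∫⁻ z in Q.set, ENNReal.ofReal ‖∑ k ∈ Finset.Ioc k₀ Q.k, D k z‖ ^ p)
    {W1p : (Fin d → ℝ) → Matrix (Fin n) (Fin n) ℂ} {V : DCube d → Matrix (Fin n) (Fin n) ℂ}
    (hV : IsReducing p c₁ c₂ W1p V) (J : DCube d) (k₀ : ℤ)
    (c : DCube d → (Fin d → Bool) → EuclideanSpace ℂ (Fin n)) :
    ∫⁻ z in J.set, ENNReal.ofReal ‖mApp (W1p z) (∑ k ∈ Finset.Ioc k₀ J.k,
        scaleTerm (Fcol (stopST p l₁ l₂ V) J) (fun I ε => mApp (V I)⁻¹ (c I ε)) k z)‖ ^ p ≤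
      ENNReal.ofReal (c₁⁻¹ ^ p * 2 ^ d * l₁) * ENNReal.ofReal C *
        ENNReal.ofReal (l₂ ^ (p - 1)) *
        ∫⁻ z in J.set, ENNReal.ofReal ‖∑ k ∈ Finset.Ioc k₀ J.k,
          scaleTerm (Fcol (stopST p l₁ l₂ V) J) c k z‖ ^ p := by
  have hp0 : 0 < p := by linarith
  set S := Fcol (stopST p l₁ l₂ V) J with hS
  set c' : DCube d → (Fin d → Bool) → EuclideanSpace ℂ (Fin n) :=
    fun I ε => mApp (V I)⁻¹ (c I ε) with hc'
  by_cases hJ : J ∈ S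
  swap
  · have h0 : ∀ k z, scaleTerm S c' k z = 0 := fun k z => if_neg fun h => hJ (self_mem_Fcol h)
    simp only [h0, Finset.sum_const_zero, mApp_zero, norm_zero, ENNReal.ofReal_zero,
      ENNReal.zero_rpow_of_pos hp0, lintegral_zero]
    exact zero_le
  have h1 : ∫⁻ z in J.set, ENNReal.ofReal ‖mApp (W1p z) (∑ k ∈ Finset.Ioc k₀ J.k,
        scaleTerm S c' k z)‖ ^ p ≤ ENNReal.ofReal (c₁⁻¹ ^ p * 2 ^ d * l₁) *
      ∫⁻ z in J.set, ENNReal.ofReal ‖mApp (V J) (∑ k ∈ Finset.Ioc k₀ J.k,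
        scaleTerm S c' k z)‖ ^ p := by
    refine lintegral_weight_le (k₀ := k₀) hd
      (fun Q hQ L hL hvol v => hV.lintegral_le_of_not_stopBad hp0 hc₁ hl₁
        (not_stopBad_of_mem_Fcol hd hQ) hL hvol v) ?_ ?_ (J.k - k₀).toNat hJ (by omega)
    · intro y z h
      refine Finset.sum_congr rfl fun k hk => scaleTerm_congr (DCube.cubeAt_coarsen ?_ h)
      have := (Finset.mem_Ioc.1 hk).1
      omega
    · exact fun L hL y hy z hz =>
        Finset.sum_congr rfl fun k _ => scaleTerm_const_of_mem hL hy hz k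
  have h2 := hC (fun k z => l₂ ^ ((p - 1) / p) • scaleTerm S c k z)
    (fun k z => mApp (V J) (scaleTerm S c' k z))
    (fun k y z h => by simp only [scaleTerm_congr h])
    (fun k y z h => by simp only [scaleTerm_congr h])
    (fun Q => by rw [← Finset.smul_sum, sum_scaleTerm_child, smul_zero])
    (fun Q => by rw [← mApp_sum, sum_scaleTerm_child, mApp_zero])
    (fun k z => norm_mApp_scaleTerm_le hd hp hl₂ (fun I => (hV I).1) J c k z) k₀ J
  simp only [← mApp_sum, ← Finset.smul_sum, norm_smul,
    Real.norm_of_nonneg (Real.rpow_nonneg hl₂ _),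
    ENNReal.ofReal_mul (Real.rpow_nonneg hl₂ ((p - 1) / p)),
    ENNReal.mul_rpow_of_nonneg _ _ hp0.le,
    ENNReal.ofReal_rpow_of_nonneg (Real.rpow_nonneg hl₂ ((p - 1) / p)) hp0.le,
    ← Real.rpow_mul hl₂, div_mul_cancel₀ _ hp0.ne'] at h2
  rw [lintegral_const_mul' _ _ ENNReal.ofReal_ne_top] at h2
  refine h1.trans ((mul_le_mul_right h2 _).trans (le_of_eq ?_))
  ring

end Multiplier

/-- With the stopping time `𝒥 = stopST p λ₁ λ₂ V` as in the decay lemma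
(`λ₁` depending only on `n, d, p`, `λ₂ = C_λ ‖W‖_{A_p}^{p'/p}`), with
`T f = ∑_{I ∈ 𝒟(I₀)} ∑_{ε ∈ 𝒮} W^{1/p} V_I^{-1} f_I^ε h_I^ε` and `T_j f = T (Δ_j f)`,
one has `∫ |T_j f|^p ≤ C ‖W‖_{A_p} ‖Δ_j f‖_{L^p}^p` for every `f` with finite Haar
expansion and every `j ≥ 1`, where `C = C(p, n, d)` does not depend on `I₀`. -/
theorem statement10 (d n : ℕ) (hd : 0 < d) (hn : 0 < n) (p c₁ c₂ : ℝ)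
    (hp : 1 < p) (hc₁ : 0 < c₁) (hc₂ : 0 < c₂) :
    ∃ l₁ Cl : ℝ, ∃ C : ℝ≥0∞, 1 < l₁ ∧ 0 < Cl ∧ 0 < C ∧ C < ⊤ ∧
      ∀ (W1p : (Fin d → ℝ) → Matrix (Fin n) (Fin n) ℂ)
        (V : DCube d → Matrix (Fin n) (Fin n) ℂ)
        (I₀ : DCube d)
        (f : (Fin d → ℝ) → EuclideanSpace ℂ (Fin n)) (j : ℕ),
        MatMeasurable W1p →
        (∀ᵐ x ∂(volume : Measure (Fin d → ℝ)), (W1p x).PosDef) →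
        apNorm p W1p < ⊤ →
        IsReducing p c₁ c₂ W1p V →
        FiniteHaar f →
        1 ≤ j →
        ∫⁻ x, ENNReal.ofReal
            ‖mApp (W1p x)
              (projInv V {J : DCube d | J.set ⊆ I₀.set}
                (deltaHaar (stopST p l₁ (Cl * (apNorm p W1p).toReal ^ (1 / (p - 1))) V)
                  I₀ j f)
                x)‖ ^ p ≤
          C * apNorm p W1p *
            ∫⁻ x, ENNReal.ofReal
              ‖deltaHaar (stopST p l₁ (Cl * (apNorm p W1p).toReal ^ (1 / (p - 1))) V)
                I₀ j f x‖ ^ p := by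
  let _ : InnerProductSpace ℝ (EuclideanSpace ℂ (Fin n)) := InnerProductSpace.complexToReal
  obtain ⟨C, hC, hmart⟩ := exists_martingale_transform_bound (EuclideanSpace ℂ (Fin n)) hp
  refine ⟨2, 1, ENNReal.ofReal (c₁⁻¹ ^ p * 2 ^ d * 2) * ENNReal.ofReal C, one_lt_two, one_pos,
    ENNReal.mul_pos (ENNReal.ofReal_pos.2 (by positivity)).ne' (ENNReal.ofReal_pos.2 hC).ne',
    ENNReal.mul_lt_top ENNReal.ofReal_lt_top ENNReal.ofReal_lt_top, ?_⟩
  intro W1p V I₀ f j _ _ hap hV hf _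
  have hp0 : 0 < p := by linarith
  rw [one_mul]
  set l₂ := (apNorm p W1p).toReal ^ (1 / (p - 1)) with hl₂
  have hl₂0 : 0 ≤ l₂ := Real.rpow_nonneg ENNReal.toReal_nonneg _
  have hl₂p : ENNReal.ofReal (l₂ ^ (p - 1)) = apNorm p W1p := by
    rw [hl₂, ← Real.rpow_mul ENNReal.toReal_nonneg, one_div,
      inv_mul_cancel₀ (by linarith : p - 1 ≠ 0), Real.rpow_one, ENNReal.ofReal_toReal hap.ne]
  set 𝒥 := stopST p 2 l₂ V
  have hdis : IsStopping 𝒥 := isStopping_stopST p 2 l₂ V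
  obtain ⟨k₀, hk₀⟩ := hf.exists_scale
  have hk₀' : ∀ I : DCube d, I.k ≤ k₀ → ∀ ε ∈ Sfin d, mApp (V I)⁻¹ (haarCoef f I ε) = 0 :=
    fun I hI ε hε => by rw [hk₀ I hI ε hε, mApp_zero]
  simp only [projInv_deltaHaar hd hdis V I₀ j hf]
  set S := ⋃ J : JIter 𝒥 (j - 1) I₀, (J : DCube d).set with hS
  have hdisj : Pairwise (Function.onFun Disjoint
      fun J : JIter 𝒥 (j - 1) I₀ => (J : DCube d).set) := fun J K hne =>
    Set.disjoint_left.2 fun z hzJ hzK =>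
      hne (Subtype.ext (hdis.eq_of_mem_JIter J.2 K.2 hzJ hzK))
  have hsupp : (Function.support fun x => ENNReal.ofReal ‖mApp (W1p x)
      (∑' I : Fj 𝒥 I₀ j, haarTerm (fun I ε => mApp (V I)⁻¹ (haarCoef f I ε)) (I : DCube d) x)‖ ^ p)
      ⊆ S := by
    intro z hz
    by_contra hzS
    refine hz ?_
    simp only [tsum_Fj_eq_zero _ hzS, mApp_zero, norm_zero, ENNReal.ofReal_zero,
      ENNReal.zero_rpow_of_pos hp0]
  rw [← setLIntegral_eq_of_support_subset hsupp]
  refine le_trans ?_ (mul_le_mul_right (setLIntegral_le_lintegral S _) _)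
  rw [hS, lintegral_iUnion (fun J => DCube.measurableSet_set _) hdisj,
    lintegral_iUnion (fun J => DCube.measurableSet_set _) hdisj, ← ENNReal.tsum_mul_left]
  refine ENNReal.tsum_le_tsum fun J => ?_
  have hTj := setLIntegral_congr_fun (μ := volume) (J : DCube d).measurableSet_set fun z hz =>
    congrArg (fun v => ENNReal.ofReal ‖mApp (W1p z) v‖ ^ p)
      (tsum_Fj_eq_sum_scaleTerm hd hdis hk₀' J.2 hz)
  have hΔj := setLIntegral_congr_fun (μ := volume) (J : DCube d).measurableSet_set fun z hz =>
    congrArg (fun v => ENNReal.ofReal ‖v‖ ^ p) (tsum_Fj_eq_sum_scaleTerm hd hdis hk₀ J.2 hz)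
  refine hTj.trans_le ((lintegral_scaleTerm_le hd hp hc₁ zero_le_two hl₂0 hmart hV J k₀
    (haarCoef f)).trans_eq ?_)
  rw [hl₂p]
  exact congrArg _ hΔj.symm

end
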